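/- arXiv:1112.2131 — 2 statements merged into one kernel-verified Lean document; each statement's English description precedes it below -/
import Mathlib

section
/- Let k be a C1 field and let X ⊂ ℙⁿ_k be a hypersurface of degree 3. If the singular locus of X contains a k-rational point, then [X] ≡ 1 mod 𝕃 in K₀(Var_k). -/
open AlgebraicGeometry CategoryTheory CategoryTheory.Limits MvPolynomial

universe u v

noncomputable section

attribute [local instance] MvPolynomial.gradedAlgebra

/-- The base scheme `Spec k`. -/
abbrev SpecBase (k : Type u) [Field k] : Scheme.{u} := Spec (CommRingCat.of k)

/-- The affine line `𝔸¹_k` as a scheme over `k`. -/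
def AffineLine (k : Type u) [Field k] : Scheme.{u} := Spec (CommRingCat.of (Polynomial k))

/-- The structure morphism of `𝔸¹_k`. -/
def AffineLine.toSpec (k : Type u) [Field k] : AffineLine k ⟶ SpecBase k :=
  Spec.map (CommRingCat.ofHom (algebraMap k (Polynomial k)))

/-- Projective `n`-space `ℙⁿ_k = Proj k[x₀, …, xₙ]` over `k`. -/
def ProjSpace (k : Type u) [Field k] (n : ℕ) : Scheme.{u} :=
  Proj (homogeneousSubmodule (Fin (n + 1)) k)

/-- The structure morphism of `ℙⁿ_k`. -/
def ProjSpace.toSpec (k : Type u) [Field k] (n : ℕ) : ProjSpace k n ⟶ SpecBase k :=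
  Proj.toSpecZero _ ≫ Spec.map (CommRingCat.ofHom (algebraMap k _))

/-- `X` (a scheme over `k` via `sX : X ⟶ Spec k`) is the reduced closed subvariety of `ℙⁿ_k`
cut out by the family `S` of polynomials, i.e. `X → ℙⁿ_k` is a closed immersion of the reduced
scheme `X` onto the zero locus of `S`, compatibly with the structure morphisms. -/
def IsProjSubvariety (k : Type u) [Field k] (n : ℕ) (S : Set (MvPolynomial (Fin (n + 1)) k))
    (X : Scheme.{u}) (sX : X ⟶ SpecBase k) : Prop :=
  IsReduced X ∧ ∃ i : X ⟶ ProjSpace k n, IsClosedImmersion i ∧ i ≫ ProjSpace.toSpec k n = sX ∧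
    Set.range i.base = ProjectiveSpectrum.zeroLocus (homogeneousSubmodule (Fin (n + 1)) k) S

/-- `X` has a `k`-rational point, i.e. the structure morphism has a section. -/
def HasRatPoint (k : Type u) [Field k] (X : Scheme.{u}) (sX : X ⟶ SpecBase k) : Prop :=
  ∃ p : SpecBase k ⟶ X, p ≫ sX = 𝟙 (SpecBase k)

/-- A motivic measure on varieties over `k` with values in a commutative ring `R`: an
assignment, to every scheme over `k`, of an element of `R` which, on separated schemes of
finite type over `k` (i.e. on the category `Var_k`, reducedness being irrelevant), is
invariant under isomorphisms over `k`, satisfies the scissor relations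
`[X] = [X ∖ Z] + [Z]` for closed subschemes `Z ⊆ X`, is multiplicative on fibre products
over `k`, and sends `Spec k` to `1`.  These are exactly the defining relations of the
Grothendieck ring of varieties `K₀(Var_k)`, so an identity holds in `K₀(Var_k)` if and
only if it holds for every motivic measure. -/
structure MotivicMeasure (k : Type u) [Field k] (R : Type v) [CommRing R] where
  cl : ∀ (X : Scheme.{u}), (X ⟶ SpecBase k) → R
  cl_point : cl (SpecBase k) (𝟙 (SpecBase k)) = 1
  cl_iso : ∀ {X Y : Scheme.{u}} (sX : X ⟶ SpecBase k) (sY : Y ⟶ SpecBase k) (e : X ≅ Y),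
    LocallyOfFiniteType sX → QuasiCompact sX → IsSeparated sX →
    e.hom ≫ sY = sX → cl X sX = cl Y sY
  cl_scissor : ∀ {X Z : Scheme.{u}} (sX : X ⟶ SpecBase k) (i : Z ⟶ X),
    LocallyOfFiniteType sX → QuasiCompact sX → IsSeparated sX →
    IsClosedImmersion i → ∀ U : X.Opens, (U : Set X) = (Set.range i.base)ᶜ →
    cl X sX = cl U.toScheme (U.ι ≫ sX) + cl Z (i ≫ sX)
  cl_prod : ∀ {X Y : Scheme.{u}} (sX : X ⟶ SpecBase k) (sY : Y ⟶ SpecBase k),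
    LocallyOfFiniteType sX → QuasiCompact sX → IsSeparated sX →
    LocallyOfFiniteType sY → QuasiCompact sY → IsSeparated sY →
    cl (pullback sX sY) (pullback.fst sX sY ≫ sX) = cl X sX * cl Y sY

/-- The class of the affine line, `𝕃 = [𝔸¹_k]`, under a motivic measure. -/
def MotivicMeasure.lef {k : Type u} [Field k] {R : Type v} [CommRing R]
    (μ : MotivicMeasure k R) : R :=
  μ.cl (AffineLine k) (AffineLine.toSpec k)

/-- `X` and `Y` are birational over `k`: they contain isomorphic dense open subschemes. -/
def BirationalOver (k : Type u) [Field k] (X Y : Scheme.{u})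
    (sX : X ⟶ SpecBase k) (sY : Y ⟶ SpecBase k) : Prop :=
  ∃ (U : X.Opens) (V : Y.Opens) (e : U.toScheme ≅ V.toScheme),
    Dense (U : Set X) ∧ Dense (V : Set Y) ∧ e.hom ≫ V.ι ≫ sY = U.ι ≫ sX

end

/-- A field `k` is `C1` if every homogeneous polynomial of degree `d` with `1 ≤ d ≤ n` in
the `n + 1` variables `x₀, …, xₙ` has a nontrivial zero over `k`. -/
def IsC1Field (k : Type*) [Field k] : Prop :=
  ∀ (n d : ℕ) (f : MvPolynomial (Fin (n + 1)) k), f.IsHomogeneous d → 1 ≤ d → d ≤ n →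
    ∃ a : Fin (n + 1) → k, a ≠ 0 ∧ MvPolynomial.eval a f = 0

section MotivicBasics

variable {k : Type u} [Field k] {R : Type v} [CommRing R] (μ : MotivicMeasure k R)

lemma MotivicMeasure.cl_isEmpty {X : Scheme.{u}} [IsEmpty X] (sX : X ⟶ SpecBase k) :
    μ.cl X sX = 0 := by
  have hU : ((⊥ : X.Opens) : Set X) = (Set.range (𝟙 X : X ⟶ X).base)ᶜ :=
    Subsingleton.elim _ _
  have h1 := μ.cl_scissor sX (𝟙 X) inferInstance inferInstance inferInstance inferInstance ⊥ hU
  have h2 : μ.cl X sX = μ.cl ((⊥ : X.Opens) : Scheme.{u}) ((⊥ : X.Opens).ι ≫ sX) := by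
    have : IsIso ((⊥ : X.Opens).ι) := by
      have : Surjective (⊥ : X.Opens).ι := ⟨fun x => isEmptyElim x⟩
      infer_instance
    exact (μ.cl_iso _ _ (asIso (⊥ : X.Opens).ι) inferInstance inferInstance inferInstance
      (by simp)).symm
  rw [Category.id_comp, ← h2] at h1
  simpa using h1

/-- The scissor relation for an open immersion and a complementary closed immersion. -/
lemma MotivicMeasure.cl_eq_add {X V Z : Scheme.{u}} (sX : X ⟶ SpecBase k)
    [LocallyOfFiniteType sX] [QuasiCompact sX] [IsSeparated sX]
    (j : V ⟶ X) [IsOpenImmersion j] (i : Z ⟶ X) [IsClosedImmersion i]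
    (h : Set.range j = (Set.range i)ᶜ) :
    μ.cl X sX = μ.cl V (j ≫ sX) + μ.cl Z (i ≫ sX) := by
  have : IsLocallyNoetherian X := LocallyOfFiniteType.isLocallyNoetherian sX
  rw [μ.cl_scissor sX i inferInstance inferInstance inferInstance inferInstance j.opensRange h]
  congr 1
  have : IsNoetherian X := {
    toCompactSpace := QuasiCompact.compactSpace_of_compactSpace sX }
  refine μ.cl_iso _ _ j.isoOpensRange.symm inferInstance inferInstance inferInstance ?_
  rw [← Category.assoc]
  congr 1
  simp

/-- The class of a closed subscheme depends only on its underlying set. -/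
lemma MotivicMeasure.cl_eq_of_range_eq {Y Z₁ Z₂ : Scheme.{u}} (sY : Y ⟶ SpecBase k)
    [LocallyOfFiniteType sY] [QuasiCompact sY] [IsSeparated sY]
    (i₁ : Z₁ ⟶ Y) [IsClosedImmersion i₁] (i₂ : Z₂ ⟶ Y) [IsClosedImmersion i₂]
    (h : Set.range i₁ = Set.range i₂) :
    μ.cl Z₁ (i₁ ≫ sY) = μ.cl Z₂ (i₂ ≫ sY) := by
  have key : ∀ {W Z : Scheme.{u}} (s : Z ⟶ SpecBase k) (_ : LocallyOfFiniteType s)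
      (_ : QuasiCompact s) (_ : IsSeparated s) (i : W ⟶ Z) (_ : IsClosedImmersion i)
      (_ : Set.range i = Set.univ), μ.cl Z s = μ.cl W (i ≫ s) := by
    intro W Z s _ _ _ i _ hi
    have h1 := μ.cl_scissor s i inferInstance inferInstance inferInstance inferInstance ⊥
      (by rw [show Set.range i.base = Set.univ from hi]; simp)
    have : IsEmpty ((⊥ : Z.Opens) : Scheme.{u}) := ⟨fun x => x.2⟩
    rw [h1, μ.cl_isEmpty, zero_add]
  rw [key (i₁ ≫ sY) inferInstance inferInstance inferInstance (pullback.fst i₁ i₂)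
    inferInstance, key (i₂ ≫ sY) inferInstance inferInstance inferInstance (pullback.snd i₁ i₂)
    inferInstance, pullback.condition_assoc]
  · rw [Scheme.Pullback.range_snd, h, Set.preimage_range]
  · rw [Scheme.Pullback.range_fst, ← h, Set.preimage_range]

/-- The class of the spectrum of a `k`-algebra. -/
noncomputable def MotivicMeasure.clAlg (A : Type u) [CommRing A] [Algebra k A] : R :=
  μ.cl (Spec (CommRingCat.of A)) (Spec.map (CommRingCat.ofHom (algebraMap k A)))

section clAlg

variable (A B : Type u) [CommRing A] [Algebra k A] [CommRing B] [Algebra k B]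

lemma locallyOfFiniteType_specMap_algebraMap [Algebra.FiniteType k A] :
    LocallyOfFiniteType (Spec.map (CommRingCat.ofHom (algebraMap k A))) :=
  (HasRingHomProperty.Spec_iff (P := @LocallyOfFiniteType)).mpr
    (RingHom.finiteType_algebraMap.mpr ‹_›)

attribute [local instance] locallyOfFiniteType_specMap_algebraMap

variable {A B} in
lemma MotivicMeasure.clAlg_congr [Algebra.FiniteType k A] (e : A ≃ₐ[k] B) :
    μ.clAlg A = μ.clAlg B := by
  refine μ.cl_iso _ _ (Scheme.Spec.mapIso e.toRingEquiv.symm.toCommRingCatIso.op)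
    inferInstance inferInstance inferInstance ?_
  simp only [Functor.mapIso_hom, Iso.op_hom, Scheme.Spec_map, Quiver.Hom.unop_op]
  rw [← Spec.map_comp]
  congr 1
  ext x
  exact e.symm.commutes x

lemma MotivicMeasure.clAlg_base : μ.clAlg k = 1 := by
  rw [← μ.cl_point, MotivicMeasure.clAlg]
  congr 1
  exact Spec.map_id _

lemma MotivicMeasure.clAlg_eq_add [Algebra.FiniteType k A] (g : A) :
    μ.clAlg A = μ.clAlg (Localization.Away g) + μ.clAlg (A ⧸ Ideal.span {g}) := by
  have : IsClosedImmersion (Spec.map (CommRingCat.ofHom (Ideal.Quotient.mk (Ideal.span {g})))) :=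
    IsClosedImmersion.spec_of_surjective _ Ideal.Quotient.mk_surjective
  rw [MotivicMeasure.clAlg, μ.cl_eq_add _
    (Spec.map (CommRingCat.ofHom (algebraMap A (Localization.Away g))))
    (Spec.map (CommRingCat.ofHom (Ideal.Quotient.mk (Ideal.span {g})))),
    ← Spec.map_comp, ← Spec.map_comp, ← CommRingCat.ofHom_comp, ← CommRingCat.ofHom_comp,
    ← IsScalarTower.algebraMap_eq]
  · rfl
  · refine (PrimeSpectrum.localization_away_comap_range (Localization.Away g) g).trans ?_
    rw [PrimeSpectrum.basicOpen_eq_zeroLocus_compl]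
    congr 1
    refine Eq.symm ((range_comap_of_surjective _ _
      Ideal.Quotient.mk_surjective).trans ?_)
    simp

open TensorProduct in
lemma MotivicMeasure.clAlg_polynomial [Algebra.FiniteType k A] :
    μ.clAlg (Polynomial A) = μ.clAlg A * μ.lef := by
  rw [MotivicMeasure.lef]
  change _ = _ * μ.clAlg (Polynomial k)
  unfold MotivicMeasure.clAlg
  rw [← μ.cl_prod _ _ inferInstance inferInstance inferInstance inferInstance inferInstance
    inferInstance]
  refine (μ.clAlg_congr (polyEquivTensor k A)).trans ?_
  have : Algebra.FiniteType k (A ⊗[k] Polynomial k) :=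
    .equiv inferInstance (polyEquivTensor k A)
  refine μ.cl_iso _ _ (pullbackSpecIso k A (Polynomial k)).symm
    inferInstance inferInstance inferInstance ?_
  simp only [Iso.symm_hom]
  rw [pullbackSpecIso_inv_fst_assoc, ← Spec.map_comp]
  rfl

end clAlg

end MotivicBasics

section LinearFibration

open scoped Polynomial in
/-- Away from `g = 0`, the hypersurface `g X + h = 0` is the graph of `-h / g`. -/
lemma exists_localization_linear_equiv {A W Ag Wg : Type u} [CommRing A] [CommRing W]
    [CommRing Ag] [CommRing Wg] [Algebra A Ag] [Algebra W Wg] (g h : A) (π : A[X] →+* W)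
    (hπ : Function.Surjective π)
    (hker : RingHom.ker π = Ideal.span {Polynomial.C g * Polynomial.X + Polynomial.C h})
    [IsLocalization.Away g Ag] [IsLocalization.Away (π (Polynomial.C g)) Wg] :
    ∃ e : Wg ≃+* Ag, ∀ a, e (algebraMap W Wg (π (Polynomial.C a))) = algebraMap A Ag a := by
  have hgu : IsUnit (algebraMap A Ag g) := IsLocalization.Away.algebraMap_isUnit g
  obtain ⟨u, hu⟩ := hgu.exists_right_inv
  let θ : A[X] →+* Ag := Polynomial.eval₂RingHom (algebraMap A Ag) (-(algebraMap A Ag h) * u)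
  have hθC : ∀ a, θ (Polynomial.C a) = algebraMap A Ag a := fun a => by simp [θ]
  have hθX : θ Polynomial.X = -(algebraMap A Ag h) * u := by simp [θ]
  have hθ : RingHom.ker π ≤ RingHom.ker θ := by
    rw [hker, Ideal.span_singleton_le_iff_mem, RingHom.mem_ker, map_add, map_mul, hθC, hθC, hθX]
    linear_combination (-(algebraMap A Ag h)) * hu
  let φ : W →+* Ag := π.liftOfSurjective hπ ⟨θ, hθ⟩
  have hφ : ∀ p, φ (π p) = θ p := fun p =>
    RingHom.liftOfRightInverse_comp_apply _ _ (Function.rightInverse_surjInv hπ) ⟨θ, hθ⟩ p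
  have hgb : IsUnit (algebraMap W Wg (π (Polynomial.C g))) :=
    IsLocalization.Away.algebraMap_isUnit _
  let ψ : A →+* Wg := (algebraMap W Wg).comp (π.comp Polynomial.C)
  have hψ : ∀ a, ψ a = algebraMap W Wg (π (Polynomial.C a)) := fun _ => rfl
  let f₁ : Wg →+* Ag := IsLocalization.Away.lift (π (Polynomial.C g)) (g := φ)
    (by rw [hφ, hθC]; exact hgu)
  let f₂ : Ag →+* Wg := IsLocalization.Away.lift g (g := ψ) hgb
  have hf₁ : ∀ w, f₁ (algebraMap _ _ w) = φ w := fun w => IsLocalization.Away.lift_eq _ _ w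
  have hf₂ : ∀ a, f₂ (algebraMap _ _ a) = ψ a := fun a => IsLocalization.Away.lift_eq _ _ a
  have h12 : f₁.comp f₂ = RingHom.id _ := by
    refine IsLocalization.ringHom_ext (Submonoid.powers g) (RingHom.ext fun a => ?_)
    simp only [RingHom.comp_apply, RingHom.id_apply, hf₂, hψ, hf₁, hφ, hθC]
  have h21 : f₂.comp f₁ = RingHom.id _ := by
    refine IsLocalization.ringHom_ext (Submonoid.powers (π (Polynomial.C g)))
      ((RingHom.cancel_right hπ).mp (Polynomial.ringHom_ext (fun a => ?_) ?_))
    · simp only [RingHom.comp_apply, RingHom.id_apply, hf₁, hφ, hθC, hf₂, hψ]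
    · simp only [RingHom.comp_apply, RingHom.id_apply, hf₁, hφ, hθX]
      have hrel : π (Polynomial.C g * Polynomial.X + Polynomial.C h) = 0 := by
        rw [← RingHom.mem_ker, hker]
        exact Ideal.subset_span rfl
      have hrel' := congrArg (algebraMap _ Wg) hrel
      have hu' := congrArg f₂ hu
      simp only [map_mul, map_add, map_zero, map_one, hf₂] at hrel' hu'
      rw [← hψ, ← hψ] at hrel'
      rw [map_mul, map_neg, hf₂]
      linear_combination (-(f₂ u)) * hrel' + (algebraMap _ Wg (π Polynomial.X)) * hu'
  exact ⟨RingEquiv.ofRingHom f₁ f₂ h12 h21, fun a => by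
    simp only [RingEquiv.ofRingHom_apply, hf₁, hφ, hθC]⟩

variable {k : Type u} [Field k] {R : Type v} [CommRing R] (μ : MotivicMeasure k R)

lemma MotivicMeasure.clAlg_quotient_eq_add {P : Type u} [CommRing P] [Algebra k P]
    [Algebra.FiniteType k P] (I : Ideal P) (g : P) :
    μ.clAlg (P ⧸ I) = μ.clAlg (Localization.Away (Ideal.Quotient.mk I g)) +
      μ.clAlg (P ⧸ (I ⊔ Ideal.span {g})) := by
  rw [μ.clAlg_eq_add _ (Ideal.Quotient.mk I g)]
  congr 1
  refine μ.clAlg_congr (AlgEquiv.trans (Ideal.quotientEquivAlgOfEq k ?_)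
    (DoubleQuot.quotQuotEquivQuotSupₐ k I (Ideal.span {g})))
  rw [Ideal.map_span, Set.image_singleton]
  rfl

open scoped Polynomial in
lemma MotivicMeasure.clAlg_quotient_map_C {A : Type u} [CommRing A] [Algebra k A]
    [Algebra.FiniteType k A] (J : Ideal A) :
    μ.clAlg (A[X] ⧸ J.map Polynomial.C) = μ.clAlg (A ⧸ J) * μ.lef := by
  rw [← μ.clAlg_polynomial]
  refine (μ.clAlg_congr (AlgEquiv.ofRingEquiv
    (f := J.polynomialQuotientEquivQuotientPolynomial) fun r => ?_)).symm
  have : algebraMap k (A ⧸ J)[X] r =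
      (Polynomial.C (algebraMap k A r) : A[X]).map (Ideal.Quotient.mk J) := by
    rw [Polynomial.map_C]; rfl
  rw [this, Ideal.polynomialQuotientEquivQuotientPolynomial_map_mk]
  rfl

open scoped Polynomial in
lemma MotivicMeasure.clAlg_linear {A : Type u} [CommRing A] [Algebra k A]
    [Algebra.FiniteType k A] (g h : A) :
    μ.clAlg (A[X] ⧸ Ideal.span {Polynomial.C g * Polynomial.X + Polynomial.C h}) =
      μ.clAlg A - μ.clAlg (A ⧸ Ideal.span {g}) + μ.clAlg (A ⧸ Ideal.span {g, h}) * μ.lef := by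
  set p : A[X] := Polynomial.C g * Polynomial.X + Polynomial.C h with hp
  rw [μ.clAlg_eq_add A g, μ.clAlg_quotient_eq_add (Ideal.span {p}) (Polynomial.C g),
    ← μ.clAlg_quotient_map_C]
  have e : Ideal.span {p} ⊔ Ideal.span {Polynomial.C g} =
      (Ideal.span {g, h}).map Polynomial.C := by
    rw [Ideal.map_span, Set.image_pair, ← Ideal.span_union, Set.singleton_union,
      Ideal.span_pair_comm, ← Ideal.span_pair_add_mul_left (x := Polynomial.C g)
        (y := Polynomial.C h) Polynomial.X]
    congr 2
    rw [hp]
    ring_nf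
  let q : A[X] ⧸ Ideal.span {p} := Ideal.Quotient.mk (Ideal.span {p}) (Polynomial.C g)
  have : Algebra.FiniteType k (Localization.Away q) :=
    .trans (S := A[X] ⧸ Ideal.span {p}) inferInstance
      (IsLocalization.finiteType_of_monoid_fg (Submonoid.powers q) _)
  obtain ⟨e', he'⟩ := exists_localization_linear_equiv (Ag := Localization.Away g)
    (Wg := Localization.Away q) g h
    (Ideal.Quotient.mk _) Ideal.Quotient.mk_surjective Ideal.mk_ker
  rw [μ.clAlg_congr (A := Localization.Away q) (AlgEquiv.ofRingEquiv (f := e') fun r => ?_), e]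
  · ring
  · rw [IsScalarTower.algebraMap_apply k A (Localization.Away g), ← he',
      IsScalarTower.algebraMap_apply k (A[X] ⧸ Ideal.span {p}) (Localization.Away q)]
    rfl

end LinearFibration

section CoordinateChange

variable {k : Type u} [Field k]

lemma exists_linearEquiv_apply_eq_of_ne_zero {V : Type*} [AddCommGroup V] [Module k V]
    {v w : V} (hv : v ≠ 0) (hw : w ≠ 0) : ∃ g : V ≃ₗ[k] V, g v = w := by
  let f := (LinearEquiv.toSpanNonzeroSingleton k V v hv).symm ≪≫ₗ
    LinearEquiv.toSpanNonzeroSingleton k V w hw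
  obtain ⟨g, hg⟩ := Submodule.exists_linearEquiv_restrict_eq f
  refine ⟨g, ?_⟩
  have h := hg (LinearEquiv.toSpanNonzeroSingleton k V v hv 1)
  rw [LinearEquiv.toSpanNonzeroSingleton_apply] at h
  simp only [one_smul] at h
  rw [← h]
  have : (⟨v, Submodule.mem_span_singleton_self v⟩ : Submodule.span k {v}) =
      LinearEquiv.toSpanNonzeroSingleton k V v hv 1 := by
    rw [LinearEquiv.toSpanNonzeroSingleton_apply]; simp
  simp only [f, LinearEquiv.trans_apply]
  rw [this, LinearEquiv.symm_apply_apply, LinearEquiv.toSpanNonzeroSingleton_apply]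
  exact one_smul k w

lemma MvPolynomial.eval_bind₁ {σ τ A : Type*} [CommRing A] (c : τ → A)
    (g : σ → MvPolynomial τ A) (p : MvPolynomial σ A) :
    eval c (bind₁ g p) = eval (fun i => eval c (g i)) p := by
  induction p using MvPolynomial.induction_on with
  | C a => simp
  | add p q hp hq => simp [hp, hq]
  | mul_X p i hp => simp [hp]

lemma MvPolynomial.eval_pderiv_bind₁ {σ τ A : Type*} [Fintype σ] [CommRing A] (c : τ → A)
    (g : σ → MvPolynomial τ A) (j : τ) (p : MvPolynomial σ A) :
    eval c (pderiv j (bind₁ g p)) =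
      ∑ i, eval (fun i => eval c (g i)) (pderiv i p) * eval c (pderiv j (g i)) := by
  classical
  induction p using MvPolynomial.induction_on with
  | C a => simp
  | add p q hp hq => simp [hp, hq, add_mul, Finset.sum_add_distrib]
  | mul_X p i hp =>
    simp only [map_mul, bind₁_X_right, Derivation.leibniz, smul_eq_mul, map_add, hp, eval_X,
      add_mul, Finset.sum_add_distrib, pderiv_X, MvPolynomial.eval_bind₁, Finset.mul_sum]
    congr 1
    · rw [Finset.sum_eq_single i]
      · simp
      · intro b _ hb
        simp [hb.symm]
      · simp
    · exact Finset.sum_congr rfl fun _ _ => by ring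

/-- A linear change of coordinates moving the point `(1 : 0 : ⋯ : 0)` to a given point. -/
lemma exists_coordinate_change {n : ℕ} {a : Fin (n + 1) → k} (ha : a ≠ 0) :
    ∃ φ : MvPolynomial (Fin (n + 1)) k ≃ₐ[k] MvPolynomial (Fin (n + 1)) k,
      (∀ d f, f.IsHomogeneous d → (φ f).IsHomogeneous d) ∧
      (∀ f, eval (Pi.single 0 1) (φ f) = eval a f) ∧
      ∀ f, (∀ i, eval a (pderiv i f) = 0) → ∀ j, eval (Pi.single 0 1) (pderiv j (φ f)) = 0 := by
  have h0 : (Pi.single 0 1 : Fin (n + 1) → k) ≠ 0 := by simp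
  obtain ⟨g, hg⟩ := exists_linearEquiv_apply_eq_of_ne_zero (k := k) h0 ha
  let M : Matrix (Fin (n + 1)) (Fin (n + 1)) k := LinearMap.toMatrix' (g : _ →ₗ[k] _)
  let N : Matrix (Fin (n + 1)) (Fin (n + 1)) k := LinearMap.toMatrix' (g.symm : _ →ₗ[k] _)
  have hMN : M * N = 1 := by
    rw [← LinearMap.toMatrix'_comp, LinearEquiv.comp_symm, LinearMap.toMatrix'_id]
  have hNM : N * M = 1 := by
    rw [← LinearMap.toMatrix'_comp, LinearEquiv.symm_comp, LinearMap.toMatrix'_id]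
  have hM : (fun i => eval (Pi.single 0 1) (M.toMvPolynomial i)) = a := by
    funext i
    rw [Matrix.toMvPolynomial_eval_eq_apply, ← Matrix.toLin'_apply, Matrix.toLin'_toMatrix']
    simp [hg]
  have key : ∀ P Q : Matrix (Fin (n + 1)) (Fin (n + 1)) k, P * Q = 1 →
      (bind₁ Q.toMvPolynomial).comp (bind₁ P.toMvPolynomial) = AlgHom.id k _ := by
    intro P Q h
    refine MvPolynomial.algHom_ext fun i => ?_
    rw [AlgHom.comp_apply, bind₁_X_right, ← Matrix.toMvPolynomial_mul, h,
      Matrix.toMvPolynomial_one, AlgHom.id_apply]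
  refine ⟨AlgEquiv.ofAlgHom (bind₁ M.toMvPolynomial) (bind₁ N.toMvPolynomial)
    (key N M hNM) (key M N hMN), fun d f hf => ?_, fun f => ?_, fun f hf j => ?_⟩
  · simpa using hf.aeval _ fun i => M.toMvPolynomial_isHomogeneous i
  · rw [AlgEquiv.ofAlgHom_apply, MvPolynomial.eval_bind₁, hM]
  · rw [AlgEquiv.ofAlgHom_apply, MvPolynomial.eval_pderiv_bind₁, hM]
    simp [hf]

lemma MvPolynomial.IsHomogeneous.eval_single {σ A : Type*} [Fintype σ] [DecidableEq σ]
    [CommRing A] {d : ℕ} {p : MvPolynomial σ A} (hp : p.IsHomogeneous d) (i : σ) :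
    eval (Pi.single i 1) p = coeff (Finsupp.single i d) p := by
  rw [MvPolynomial.eval_eq', Finset.sum_eq_single (Finsupp.single i d)]
  · rw [Finset.prod_eq_one, mul_one]
    intro j _
    rcases eq_or_ne j i with rfl | h
    · simp
    · simp [h.symm]
  · intro b hb hbd
    by_contra hne
    refine hbd ?_
    have hz : ∀ j, j ≠ i → b j = 0 := by
      intro j hj
      by_contra hbj
      exact hne (mul_eq_zero_of_right _ (Finset.prod_eq_zero (Finset.mem_univ j)
        (by simp [hj, hbj])))
    have hdeg : b.degree = d := by
      by_contra h
      exact (mem_support_iff.mp hb) (hp.coeff_eq_zero h)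
    have : b = Finsupp.single i (b i) := by
      ext j
      rcases eq_or_ne j i with rfl | h
      · simp
      · simp [h.symm, hz j h]
    rw [this, Finsupp.degree_single] at hdeg
    rw [this, hdeg]
  · intro h
    rw [notMem_support_iff.mp h, zero_mul]

lemma MvPolynomial.IsHomogeneous.finSuccEquiv_coeff_eq_zero {A : Type*} [CommRing A] {n d i : ℕ}
    {p : MvPolynomial (Fin (n + 1)) A} (hp : p.IsHomogeneous d) (hi : d < i) :
    (finSuccEquiv A n p).coeff i = 0 := by
  ext m
  rw [finSuccEquiv_coeff_coeff, coeff_zero]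
  refine hp.coeff_eq_zero ?_
  rw [Finsupp.degree_eq_sum, Fin.sum_univ_succ]
  simp only [Finsupp.cons_zero, Finsupp.cons_succ]
  omega

lemma MvPolynomial.IsHomogeneous.finSuccEquiv_coeff_self_eq_zero {A : Type*} [CommRing A]
    {n d : ℕ} {p : MvPolynomial (Fin (n + 1)) A} (hp : p.IsHomogeneous d)
    (h0 : eval (Pi.single 0 1) p = 0) : (finSuccEquiv A n p).coeff d = 0 := by
  rw [hp.eval_single] at h0
  have hc := hp.finSuccEquiv_coeff_isHomogeneous d 0 rfl
  ext m
  rw [coeff_zero]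
  rcases eq_or_ne m 0 with rfl | hm
  · rw [finSuccEquiv_coeff_coeff, Finsupp.cons_zero_eq_single_zero, h0]
  · exact hc.coeff_eq_zero (by simpa [Finsupp.degree_eq_zero_iff] using hm)

lemma MvPolynomial.IsHomogeneous.finSuccEquiv_coeff_pred_eq_zero {A : Type*} [CommRing A]
    {n d : ℕ} {p : MvPolynomial (Fin (n + 1)) A} (hp : p.IsHomogeneous (d + 1))
    (h0 : ∀ j, eval (Pi.single 0 1) (pderiv j p) = 0) : (finSuccEquiv A n p).coeff d = 0 := by
  have hc := hp.finSuccEquiv_coeff_isHomogeneous d 1 rfl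
  ext m
  rw [coeff_zero]
  by_cases hm : m.degree = 1
  · obtain ⟨j, rfl⟩ : ∃ j, m = Finsupp.single j 1 := by
      have : m ∈ Set.range fun a => Finsupp.single a 1 := Finsupp.range_single_one ▸ hm
      exact this.imp fun _ h => h.symm
    have h := h0 j.succ
    have hd : (pderiv j.succ p).IsHomogeneous d := hp.pderiv
    rw [hd.eval_single, coeff_pderiv] at h
    rw [finSuccEquiv_coeff_coeff]
    have : Finsupp.cons d (Finsupp.single j 1) =
        Finsupp.single 0 d + Finsupp.single j.succ 1 := by
      ext l
      refine Fin.cases ?_ (fun l => ?_) l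
      · simp
      · simp [Finsupp.single_apply]
    rw [this]
    simpa using h
  · exact hc.coeff_eq_zero hm

end CoordinateChange

section AffineCone

variable {k : Type u} [Field k] {R : Type v} [CommRing R] (μ : MotivicMeasure k R)

lemma MotivicMeasure.clAlg_mvPolynomial_fin_succ_mem (m : ℕ) :
    μ.clAlg (MvPolynomial (Fin (m + 1)) k) ∈ Ideal.span {μ.lef} := by
  rw [μ.clAlg_congr (finSuccEquiv k m), μ.clAlg_polynomial]
  exact Ideal.mul_mem_left _ _ (Ideal.mem_span_singleton_self _)

lemma MotivicMeasure.clAlg_quotient_span_singleton_congr {P Q : Type u} [CommRing P]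
    [CommRing Q] [Algebra k P] [Algebra k Q] [Algebra.FiniteType k P] (e : P ≃ₐ[k] Q) (p : P) :
    μ.clAlg (P ⧸ Ideal.span {p}) = μ.clAlg (Q ⧸ Ideal.span {e p}) :=
  μ.clAlg_congr (Ideal.quotientEquivAlg _ _ e (by
    rw [Ideal.map_span, Set.image_singleton]; rfl))

/-- If `(1 : 0 : ⋯ : 0)` is a point of multiplicity at least `d - 1` on a degree `d` cone,
projecting from this point relates the class of the cone to that of its leading coefficient. -/
lemma MotivicMeasure.clAlg_add_clAlg_coeff_one_mem {m : ℕ}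
    (p : MvPolynomial (Fin (m + 2)) k)
    (hp : ∀ i, 2 ≤ i → (finSuccEquiv k (m + 1) p).coeff i = 0) :
    μ.clAlg (MvPolynomial (Fin (m + 2)) k ⧸ Ideal.span {p}) +
      μ.clAlg (MvPolynomial (Fin (m + 1)) k ⧸
        Ideal.span {(finSuccEquiv k (m + 1) p).coeff 1}) ∈ Ideal.span {μ.lef} := by
  rw [μ.clAlg_quotient_span_singleton_congr (finSuccEquiv k (m + 1))]
  have h := Polynomial.eq_X_add_C_of_natDegree_le_one (p := finSuccEquiv k (m + 1) p)
    (Polynomial.natDegree_le_iff_coeff_eq_zero.mpr fun i hi => hp i hi)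
  rw [congrArg (fun q => μ.clAlg (_ ⧸ Ideal.span {q})) h, μ.clAlg_linear]
  rw [add_right_comm, sub_add_cancel]
  exact add_mem (μ.clAlg_mvPolynomial_fin_succ_mem m)
    (Ideal.mul_mem_left _ _ (Ideal.mem_span_singleton_self _))

/-- The affine cone over a hyperplane. -/
lemma MotivicMeasure.clAlg_linear_form_mem (hk : IsC1Field k) {m : ℕ}
    (l : MvPolynomial (Fin (m + 2)) k) (hl : l.IsHomogeneous 1) :
    μ.clAlg (MvPolynomial (Fin (m + 2)) k ⧸ Ideal.span {l}) ∈ Ideal.span {μ.lef} := by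
  obtain ⟨a, ha, hal⟩ := hk _ _ l hl le_rfl (by omega)
  obtain ⟨φ, hφ, hφ₀, -⟩ := exists_coordinate_change ha
  have h := μ.clAlg_add_clAlg_coeff_one_mem (φ l)
    fun i hi => (hφ _ _ hl).finSuccEquiv_coeff_eq_zero hi
  rw [(hφ _ _ hl).finSuccEquiv_coeff_self_eq_zero (by rw [hφ₀, hal]),
    ← μ.clAlg_quotient_span_singleton_congr, Ideal.span_singleton_eq_bot.mpr rfl,
    μ.clAlg_congr (AlgEquiv.quotientBot k (MvPolynomial (Fin (m + 1)) k))] at h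
  exact (Ideal.add_mem_iff_left _ (μ.clAlg_mvPolynomial_fin_succ_mem m)).mp h

/-- The affine cone over a quadric over a `C1` field. -/
lemma MotivicMeasure.clAlg_quadratic_form_mem (hk : IsC1Field k) {m : ℕ}
    (q : MvPolynomial (Fin (m + 3)) k) (hq : q.IsHomogeneous 2) :
    μ.clAlg (MvPolynomial (Fin (m + 3)) k ⧸ Ideal.span {q}) ∈ Ideal.span {μ.lef} := by
  obtain ⟨a, ha, haq⟩ := hk _ _ q hq (by omega) (by omega)
  obtain ⟨φ, hφ, hφ₀, -⟩ := exists_coordinate_change ha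
  rw [μ.clAlg_quotient_span_singleton_congr φ]
  refine (Ideal.add_mem_iff_left _ (μ.clAlg_linear_form_mem hk _
    ((hφ _ _ hq).finSuccEquiv_coeff_isHomogeneous 1 1 rfl))).mp
    (μ.clAlg_add_clAlg_coeff_one_mem (φ q) fun i hi => ?_)
  rcases hi.eq_or_lt with rfl | hi
  · exact (hφ _ _ hq).finSuccEquiv_coeff_self_eq_zero (by rw [hφ₀, haq])
  · exact (hφ _ _ hq).finSuccEquiv_coeff_eq_zero hi

/-- The affine cone over a cubic with a singular rational point over a `C1` field. -/
lemma MotivicMeasure.clAlg_singular_cubic_form_mem (hk : IsC1Field k) {m : ℕ}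
    (f : MvPolynomial (Fin (m + 4)) k) (hf : f.IsHomogeneous 3) (a : Fin (m + 4) → k)
    (ha : a ≠ 0) (haf : eval a f = 0) (hsing : ∀ i, eval a (pderiv i f) = 0) :
    μ.clAlg (MvPolynomial (Fin (m + 4)) k ⧸ Ideal.span {f}) ∈ Ideal.span {μ.lef} := by
  obtain ⟨φ, hφ, hφ₀, hφ₁⟩ := exists_coordinate_change ha
  rw [μ.clAlg_quotient_span_singleton_congr φ]
  refine (Ideal.add_mem_iff_left _ (μ.clAlg_quadratic_form_mem hk _
    ((hφ _ _ hf).finSuccEquiv_coeff_isHomogeneous 1 2 rfl))).mp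
    (μ.clAlg_add_clAlg_coeff_one_mem (φ f) fun i hi => ?_)
  rcases hi.eq_or_lt with rfl | hi
  · exact (hφ _ _ hf).finSuccEquiv_coeff_pred_eq_zero (hφ₁ f hsing)
  rcases (Nat.succ_le_of_lt hi).eq_or_lt with rfl | hi
  · exact (hφ _ _ hf).finSuccEquiv_coeff_self_eq_zero (by rw [hφ₀, haf])
  · exact (hφ _ _ hf).finSuccEquiv_coeff_eq_zero hi

end AffineCone

section Dehomogenization

attribute [local instance] MvPolynomial.gradedAlgebra

lemma MvPolynomial.IsHomogeneous.aeval_mul {σ k A : Type*} [CommRing k] [CommRing A]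
    [Algebra k A] {p : MvPolynomial σ k} {d : ℕ} (hp : p.IsHomogeneous d) (u : A) (y : σ → A) :
    MvPolynomial.aeval (fun j => u * y j) p = u ^ d * MvPolynomial.aeval y p := by
  simp only [aeval_def, eval₂_eq, Finset.mul_sum]
  refine Finset.sum_congr rfl fun m hm => ?_
  have hdeg : m.degree = d := by
    by_contra h
    exact (mem_support_iff.mp hm) (hp.coeff_eq_zero h)
  simp only [mul_pow, Finset.prod_mul_distrib, Finset.prod_pow_eq_pow_sum]
  rw [← hdeg, Finsupp.degree_apply]
  ring

open HomogeneousLocalization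

variable {k : Type u} [Field k] {σ : Type} (x : σ)

lemma X_mem_homogeneousSubmodule (j : σ) :
    (X j : MvPolynomial σ k) ∈ homogeneousSubmodule σ k 1 := isHomogeneous_X k j

/-- Dehomogenization `k[x_j] → k[x_j / x]`. -/
noncomputable def dehomogenize :
    MvPolynomial σ k →+* Away (homogeneousSubmodule σ k) (X x : MvPolynomial σ k) :=
  eval₂Hom ((fromZeroRingHom (homogeneousSubmodule σ k) _).comp (algebraMap k _))
    fun j => Away.mk (homogeneousSubmodule σ k) (X_mem_homogeneousSubmodule x) 1 (X j)
      (by rw [one_smul]; exact X_mem_homogeneousSubmodule j)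

lemma val_dehomogenize (p : MvPolynomial σ k) :
    (dehomogenize x p).val =
      aeval (fun j => IsLocalization.Away.invSelf (X x : MvPolynomial σ k) *
        algebraMap (MvPolynomial σ k) (Localization.Away (X x)) (X j)) p := by
  change (algebraMap _ (Localization.Away (X x : MvPolynomial σ k))).comp (dehomogenize x) p =
    (aeval _).toRingHom p
  congr 1
  refine MvPolynomial.ringHom_ext (fun c => ?_) fun j => ?_
  · simp only [dehomogenize, RingHom.comp_apply, eval₂Hom_C, AlgHom.toRingHom_eq_coe,
      RingHom.coe_coe, aeval_C, HomogeneousLocalization.algebraMap_apply]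
    rfl
  · simp only [dehomogenize, RingHom.comp_apply, eval₂Hom_X', AlgHom.toRingHom_eq_coe,
      RingHom.coe_coe, aeval_X, HomogeneousLocalization.algebraMap_apply, Away.val_mk,
      Localization.mk_eq_mk', IsLocalization.Away.invSelf]
    rw [mul_comm, ← IsLocalization.mk'_one (M := Submonoid.powers (X x)), ← IsLocalization.mk'_mul]
    simp [pow_one]

lemma dehomogenize_of_isHomogeneous {p : MvPolynomial σ k} {d : ℕ}
    (hp : p ∈ homogeneousSubmodule σ k (d • 1)) :
    dehomogenize x p = Away.mk _ (X_mem_homogeneousSubmodule x) d p hp := by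
  have hp' : p.IsHomogeneous d := by simpa using hp
  have h : aeval (fun j => algebraMap (MvPolynomial σ k) (Localization.Away (X x)) (X j)) p =
      algebraMap _ (Localization.Away (X x : MvPolynomial σ k)) p := by
    have : aeval (fun j => algebraMap (MvPolynomial σ k) (Localization.Away (X x)) (X j)) =
        IsScalarTower.toAlgHom k (MvPolynomial σ k)
          (Localization.Away (X x : MvPolynomial σ k)) :=
      MvPolynomial.algHom_ext fun j => aeval_X _ _
    exact congrArg (· p) this
  refine HomogeneousLocalization.val_injective _ ?_
  rw [val_dehomogenize, hp'.aeval_mul, h, Away.val_mk, Localization.mk_eq_mk',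
    IsLocalization.eq_mk'_iff_mul_eq, mul_right_comm, map_pow, ← mul_pow,
    mul_comm (IsLocalization.Away.invSelf _), IsLocalization.Away.mul_invSelf, one_pow, one_mul]

/-- The quotient of `k[x_j / x]` by the dehomogenizations of the elements of `S`. -/
noncomputable def awayQuotient (S : Set (MvPolynomial σ k)) :
    Away (homogeneousSubmodule σ k) (X x : MvPolynomial σ k) →+*
      MvPolynomial σ k ⧸ Ideal.span (insert (X x - 1) S) :=
  (IsLocalization.Away.lift (S := Localization.Away (X x : MvPolynomial σ k)) (X x)
    (g := Ideal.Quotient.mk (Ideal.span (insert (X x - 1) S))) (by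
      have h : Ideal.Quotient.mk (Ideal.span (insert (X x - 1) S)) (X x) = 1 := by
        rw [← map_one (Ideal.Quotient.mk _), Ideal.Quotient.eq]
        exact Ideal.subset_span (Set.mem_insert _ _)
      rw [h]
      exact isUnit_one)).comp (algebraMap _ _)

lemma awayQuotient_comp_dehomogenize (S : Set (MvPolynomial σ k)) :
    (awayQuotient x S).comp (dehomogenize x) = Ideal.Quotient.mk _ := by
  have h : Ideal.Quotient.mk (Ideal.span (insert (X x - 1) S)) (X x) = 1 := by
    rw [← map_one (Ideal.Quotient.mk _), Ideal.Quotient.eq]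
    exact Ideal.subset_span (Set.mem_insert _ _)
  have hinv : ∀ (l : Localization.Away (X x : MvPolynomial σ k) →+*
      MvPolynomial σ k ⧸ Ideal.span (insert (X x - 1) S)),
      (∀ p, l (algebraMap (MvPolynomial σ k) _ p) = Ideal.Quotient.mk _ p) →
      l (IsLocalization.Away.invSelf (X x : MvPolynomial σ k)) = 1 := by
    intro l hl
    have := congrArg l (IsLocalization.Away.mul_invSelf
      (S := Localization.Away (X x : MvPolynomial σ k)) (X x : MvPolynomial σ k))
    rwa [map_mul, hl, h, one_mul, map_one] at this
  refine MvPolynomial.ringHom_ext (fun c => ?_) fun j => ?_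
  · rw [RingHom.comp_apply, awayQuotient, RingHom.comp_apply,
      HomogeneousLocalization.algebraMap_apply, val_dehomogenize,
      aeval_C, IsScalarTower.algebraMap_apply k (MvPolynomial σ k), IsLocalization.Away.lift_eq]
    rfl
  · rw [RingHom.comp_apply, awayQuotient, RingHom.comp_apply,
      HomogeneousLocalization.algebraMap_apply, val_dehomogenize,
      aeval_X, map_mul, hinv _ fun p => IsLocalization.Away.lift_eq _ _ p, one_mul,
      IsLocalization.Away.lift_eq]

lemma awayQuotient_surjective (S : Set (MvPolynomial σ k)) :
    Function.Surjective (awayQuotient x S) := by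
  refine .of_comp (g := dehomogenize x) ?_
  rw [← RingHom.coe_comp, awayQuotient_comp_dehomogenize]
  exact Ideal.Quotient.mk_surjective

lemma dehomogenize_eq_isLocalizationElem {s : MvPolynomial σ k} {d : ℕ}
    (hd : s ∈ homogeneousSubmodule σ k d) :
    dehomogenize x s = Away.isLocalizationElem (X_mem_homogeneousSubmodule x) hd := by
  rw [dehomogenize_of_isHomogeneous x (p := s) (d := d) (by simpa using hd)]
  refine HomogeneousLocalization.val_injective _ ?_
  simp only [Away.isLocalizationElem, Away.val_mk, pow_one]

lemma awayQuotient_isLocalizationElem (S : Set (MvPolynomial σ k)) {s : MvPolynomial σ k}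
    (hs : s ∈ S) {d : ℕ} (hd : s ∈ homogeneousSubmodule σ k d) :
    awayQuotient x S (Away.isLocalizationElem (X_mem_homogeneousSubmodule x) hd) = 0 := by
  rw [← dehomogenize_eq_isLocalizationElem, ← RingHom.comp_apply,
    awayQuotient_comp_dehomogenize]
  exact Ideal.Quotient.eq_zero_iff_mem.mpr (Ideal.subset_span (Set.mem_insert_of_mem _ hs))

lemma ker_awayQuotient_le (S : Set (MvPolynomial σ k))
    (I : Ideal (Away (homogeneousSubmodule σ k) (X x : MvPolynomial σ k)))
    (hI : ∀ s ∈ S, ∃ (d : ℕ) (hd : s ∈ homogeneousSubmodule σ k d),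
      Away.isLocalizationElem (X_mem_homogeneousSubmodule x) hd ∈ I) :
    RingHom.ker (awayQuotient x S) ≤ I := by
  intro b hb
  obtain ⟨d, p, hp, rfl⟩ := Away.mk_surjective _ (X_mem_homogeneousSubmodule x) b
  rw [← dehomogenize_of_isHomogeneous, RingHom.mem_ker, ← RingHom.comp_apply,
    awayQuotient_comp_dehomogenize, Ideal.Quotient.eq_zero_iff_mem] at hb
  rw [← dehomogenize_of_isHomogeneous]
  suffices Ideal.span (insert (X x - 1) S) ≤ I.comap (dehomogenize x) from this hb
  rw [Ideal.span_le, Set.insert_subset_iff]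
  refine ⟨?_, fun s hs => ?_⟩
  · have : dehomogenize x (X x : MvPolynomial σ k) = 1 := by
      refine HomogeneousLocalization.val_injective _ ?_
      rw [val_dehomogenize, aeval_X, mul_comm, IsLocalization.Away.mul_invSelf, val_one]
    simp [this]
  · obtain ⟨d, hd, h⟩ := hI s hs
    rwa [← dehomogenize_eq_isLocalizationElem] at h

end Dehomogenization

section Torus

open scoped Polynomial

variable {k : Type u} [Field k]

lemma exists_away_algHom {A B : Type*} [CommRing A] [Algebra k A] [CommRing B] [Algebra k B]
    {a : A} (g : A →ₐ[k] B) (h : IsUnit (g a)) :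
    ∃ φ : Localization.Away a →ₐ[k] B, ∀ b, φ (algebraMap A _ b) = g b := by
  have h' : ∀ y : Submonoid.powers a, IsUnit (g y) := by
    rintro ⟨_, n, rfl⟩
    simpa using h.pow n
  exact ⟨IsLocalization.liftAlgHom (S := Localization.Away a) h', fun b =>
    IsLocalization.lift_eq _ b⟩

lemma away_algHom_ext {A B : Type*} [CommRing A] [Algebra k A] [CommRing B] [Algebra k B]
    {a : A} {φ ψ : Localization.Away a →ₐ[k] B}
    (h : ∀ b, φ (algebraMap A _ b) = ψ (algebraMap A _ b)) : φ = ψ :=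
  AlgHom.coe_ringHom_injective (IsLocalization.ringHom_ext (Submonoid.powers a)
    (RingHom.ext h))

lemma exists_algHom_of_ker_eq_span {σ A B : Type*} [CommRing A] [Algebra k A] [CommRing B]
    [Algebra k B] {S : Set (MvPolynomial σ k)} {q : MvPolynomial σ k →ₐ[k] A}
    (hq : Function.Surjective q) (hker : RingHom.ker q = Ideal.span S)
    (y : σ → B) (h : ∀ s ∈ S, aeval y s = 0) :
    ∃ φ : A →ₐ[k] B, ∀ p, φ (q p) = aeval y p := by
  have h' : RingHom.ker q ≤ RingHom.ker (aeval (R := k) y) := hker ▸ Ideal.span_le.mpr h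
  refine ⟨(Ideal.Quotient.liftₐ (RingHom.ker q) (aeval (R := k) y) fun a ha => h' ha).comp
    (Ideal.quotientKerAlgEquivOfSurjective hq).symm.toAlgHom, fun p => ?_⟩
  have : (Ideal.quotientKerAlgEquivOfSurjective hq).symm (q p) = Ideal.Quotient.mk _ p := by
    rw [AlgEquiv.symm_apply_eq]
    rfl
  rw [AlgHom.comp_apply]
  refine (congrArg _ this).trans ?_
  rfl

lemma nonempty_away_algEquiv {σ A E : Type*} [CommRing A] [Algebra k A] [CommRing E]
    [Algebra k E] (x : σ) (S : Set (MvPolynomial σ k))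
    (hS : ∀ s ∈ S, ∃ d, 0 < d ∧ s.IsHomogeneous d)
    {mA : MvPolynomial σ k →ₐ[k] A} (hA : Function.Surjective mA)
    (hkA : RingHom.ker mA = Ideal.span S) {mE : MvPolynomial σ k →ₐ[k] E}
    (hE : Function.Surjective mE) (hkE : RingHom.ker mE = Ideal.span (insert (X x - 1) S)) :
    Nonempty (Localization.Away (mA (X x)) ≃ₐ[k] Localization.Away (Polynomial.X : E[X])) := by
  let lA := algebraMap A (Localization.Away (mA (X x)))
  let lE : E[X] →+* Localization.Away (Polynomial.X : E[X]) := algebraMap _ _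
  have hx1 : mE (X x) = 1 := by
    rw [← sub_eq_zero, ← map_one mE, ← map_sub, ← RingHom.mem_ker, hkE]
    exact Ideal.subset_span (Set.mem_insert _ _)
  have mE0 : ∀ s ∈ S, mE s = 0 := fun s hs =>
    (hkE ▸ Ideal.subset_span (Set.mem_insert_of_mem _ hs) : s ∈ RingHom.ker mE)
  have mA0 : ∀ s ∈ S, mA s = 0 := fun s hs =>
    (hkA ▸ Ideal.subset_span hs : s ∈ RingHom.ker mA)
  have aeE : ∀ p, aeval (fun j => lE (Polynomial.C (mE (X j)))) p = lE (Polynomial.C (mE p)) := by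
    intro p
    let φ : MvPolynomial σ k →ₐ[k] Localization.Away (Polynomial.X : E[X]) :=
      (IsScalarTower.toAlgHom k E[X] _).comp (Polynomial.CAlgHom.comp mE)
    exact congrArg (· p) (MvPolynomial.algHom_ext (g := φ) fun j => aeval_X _ _)
  have aeA : ∀ p, aeval (fun j => lA (mA (X j))) p = lA (mA p) := by
    intro p
    let φ : MvPolynomial σ k →ₐ[k] Localization.Away (mA (X x)) :=
      (IsScalarTower.toAlgHom k A _).comp mA
    exact congrArg (· p) (MvPolynomial.algHom_ext (g := φ) fun j => aeval_X _ _)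
  obtain ⟨α₀, hα₀⟩ := exists_algHom_of_ker_eq_span hA hkA
    (fun j => lE Polynomial.X * lE (Polynomial.C (mE (X j)))) (by
      intro s hs
      obtain ⟨d, -, hd⟩ := hS s hs
      rw [hd.aeval_mul, aeE, mE0 s hs, map_zero, map_zero, mul_zero])
  have hα₀x : α₀ (mA (X x)) = lE Polynomial.X := by
    rw [hα₀, aeval_X, hx1, map_one, map_one, mul_one]
  obtain ⟨α, hα⟩ := exists_away_algHom (a := mA (X x)) α₀ (by
    rw [hα₀x]; exact IsLocalization.Away.algebraMap_isUnit _)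
  let u := IsLocalization.Away.invSelf (S := Localization.Away (mA (X x))) (mA (X x))
  have hu : lA (mA (X x)) * u = 1 := IsLocalization.Away.mul_invSelf _
  obtain ⟨β₀, hβ₀⟩ := exists_algHom_of_ker_eq_span hE hkE
    (fun j => u * lA (mA (X j))) (by
      rintro s (rfl | hs)
      · rw [map_sub, aeval_X, map_one, mul_comm, hu, sub_self]
      · obtain ⟨d, -, hd⟩ := hS s hs
        rw [hd.aeval_mul, aeA, mA0 s hs, map_zero, mul_zero])
  let β₁ : E[X] →ₐ[k] Localization.Away (mA (X x)) :=
    Polynomial.eval₂AlgHom β₀ (lA (mA (X x))) fun _ => Commute.all _ _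
  have hβ₁C : ∀ e, β₁ (Polynomial.C e) = β₀ e := fun e => Polynomial.eval₂_C _ _
  have hβ₁X : β₁ Polynomial.X = lA (mA (X x)) := Polynomial.eval₂_X _ _
  obtain ⟨β, hβ⟩ := exists_away_algHom (a := (Polynomial.X : E[X])) β₁ (by
    rw [hβ₁X]; exact IsLocalization.Away.algebraMap_isUnit _)
  have hαu : α u * lE Polynomial.X = 1 := by
    rw [← hα₀x, ← hα, ← map_mul, mul_comm, hu, map_one]
  refine ⟨AlgEquiv.ofAlgHom α β ?_ ?_⟩
  · refine away_algHom_ext fun p => ?_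
    change α (β (lE p)) = lE p
    suffices (α.comp β₁) = IsScalarTower.toAlgHom k E[X] _ by
      rw [hβ]; exact congrArg (· p) this
    refine Polynomial.algHom_ext' ((AlgHom.cancel_right hE).mp
      (MvPolynomial.algHom_ext fun j => ?_)) ?_
    · change α (β₁ (Polynomial.C (mE (X j)))) = lE (Polynomial.C (mE (X j)))
      rw [hβ₁C, hβ₀, aeval_X, map_mul, hα, hα₀, aeval_X, ← mul_assoc, hαu, one_mul]
    · change α (β₁ Polynomial.X) = lE Polynomial.X
      rw [hβ₁X, hα, hα₀x]
  · refine away_algHom_ext fun p => ?_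
    change β (α (lA p)) = lA p
    suffices (β.comp α₀) = IsScalarTower.toAlgHom k _ _ by
      rw [hα]; exact congrArg (· p) this
    refine (AlgHom.cancel_right hA).mp (MvPolynomial.algHom_ext fun j => ?_)
    change β (α₀ (mA (X j))) = lA (mA (X j))
    rw [hα₀, aeval_X, map_mul, hβ, hβ, hβ₁X, hβ₁C, hβ₀, aeval_X, ← mul_assoc, hu, one_mul]

variable {R : Type v} [CommRing R] (μ : MotivicMeasure k R)

lemma MotivicMeasure.clAlg_away_polynomial_X (E : Type u) [CommRing E] [Algebra k E]
    [Algebra.FiniteType k E] :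
    μ.clAlg (Localization.Away (Polynomial.X : E[X])) = μ.clAlg E * (μ.lef - 1) := by
  have h := μ.clAlg_eq_add (A := E[X]) Polynomial.X
  have e : (E[X] ⧸ Ideal.span {(Polynomial.X : E[X])}) ≃ₐ[E] E :=
    (Ideal.quotientEquivAlgOfEq E (by rw [map_zero, sub_zero])).trans
      (Polynomial.quotientSpanXSubCAlgEquiv (0 : E))
  rw [μ.clAlg_polynomial, μ.clAlg_congr (e.restrictScalars k)] at h
  rw [mul_sub, mul_one, h, add_sub_cancel_right]

lemma MotivicMeasure.clAlg_away_X {σ : Type} [Finite σ] (x : σ)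
    (S : Set (MvPolynomial σ k)) (hS : ∀ s ∈ S, ∃ d, 0 < d ∧ s.IsHomogeneous d) :
    μ.clAlg (Localization.Away (Ideal.Quotient.mk (Ideal.span S) (X x))) =
      μ.clAlg (MvPolynomial σ k ⧸ Ideal.span (insert (X x - 1) S)) * (μ.lef - 1) := by
  obtain ⟨e⟩ := nonempty_away_algEquiv x S hS
    (Ideal.Quotient.mkₐ_surjective k (Ideal.span S)) (Ideal.Quotient.mkₐ_ker k _)
    (Ideal.Quotient.mkₐ_surjective k (Ideal.span (insert (X x - 1) S)))
    (Ideal.Quotient.mkₐ_ker k _)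
  have hft : Algebra.FiniteType k
      (Localization.Away (Ideal.Quotient.mk (Ideal.span S) (X x))) :=
    Algebra.FiniteType.trans (S := MvPolynomial σ k ⧸ Ideal.span S) inferInstance
      (IsLocalization.finiteType_of_monoid_fg (Submonoid.powers
        (Ideal.Quotient.mk (Ideal.span S) (X x))) _)
  rw [← μ.clAlg_away_polynomial_X]
  exact μ.clAlg_congr e

end Torus

section ProjectiveScheme

open HomogeneousLocalization

variable (k : Type u) [Field k] (n : ℕ)

lemma surjective_algebraMap_homogeneousSubmodule_zero (σ : Type*) :
    Function.Surjective (algebraMap k (homogeneousSubmodule σ k 0)) := by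
  rintro ⟨p, hp⟩
  refine ⟨p.coeff 0, Subtype.ext ?_⟩
  exact (totalDegree_eq_zero_iff_eq_C.mp
    (Nat.le_zero.mp (IsHomogeneous.totalDegree_le hp))).symm

lemma finiteType_homogeneousSubmodule_zero (σ : Type*) [Finite σ] :
    Algebra.FiniteType (homogeneousSubmodule σ k 0) (MvPolynomial σ k) := by
  have : IsScalarTower k (homogeneousSubmodule σ k 0) (MvPolynomial σ k) :=
    ⟨fun a b c => smul_mul_assoc a (b : MvPolynomial σ k) c⟩
  exact .of_restrictScalars_finiteType k _ _

lemma ProjSpace.isClosedImmersion_specMap :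
    IsClosedImmersion (Spec.map (CommRingCat.ofHom
      (algebraMap k (homogeneousSubmodule (Fin (n + 1)) k 0)))) :=
  .spec_of_surjective _ (surjective_algebraMap_homogeneousSubmodule_zero k _)

attribute [local instance] MvPolynomial.gradedAlgebra finiteType_homogeneousSubmodule_zero
  ProjSpace.isClosedImmersion_specMap

lemma ProjSpace.locallyOfFiniteType_toSpec :
    LocallyOfFiniteType (ProjSpace.toSpec k n) :=
  inferInstanceAs (LocallyOfFiniteType (Proj.toSpecZero (homogeneousSubmodule (Fin (n + 1)) k) ≫
    Spec.map (CommRingCat.ofHom (algebraMap k _))))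

lemma ProjSpace.quasiCompact_toSpec :
    QuasiCompact (ProjSpace.toSpec k n) :=
  inferInstanceAs (QuasiCompact (Proj.toSpecZero (homogeneousSubmodule (Fin (n + 1)) k) ≫
    Spec.map (CommRingCat.ofHom (algebraMap k _))))

lemma ProjSpace.isSeparated_toSpec :
    IsSeparated (ProjSpace.toSpec k n) :=
  inferInstanceAs (IsSeparated (Proj.toSpecZero (homogeneousSubmodule (Fin (n + 1)) k) ≫
    Spec.map (CommRingCat.ofHom (algebraMap k _))))

attribute [local instance] ProjSpace.locallyOfFiniteType_toSpec ProjSpace.quasiCompact_toSpec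
  ProjSpace.isSeparated_toSpec

variable {n}

/-- The inclusion of the affine chart `D₊(x)` in projective space. -/
noncomputable def ProjSpace.chart (x : Fin (n + 1)) :
    Spec (.of (Away (homogeneousSubmodule (Fin (n + 1)) k) (X x))) ⟶ ProjSpace k n :=
  Proj.awayι _ (X x) (X_mem_homogeneousSubmodule x) one_pos

instance (x : Fin (n + 1)) : IsOpenImmersion (ProjSpace.chart k x) :=
  inferInstanceAs (IsOpenImmersion (Proj.awayι (homogeneousSubmodule (Fin (n + 1)) k) (X x)
    (X_mem_homogeneousSubmodule x) one_pos))

lemma ProjSpace.range_chart (x : Fin (n + 1)) :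
    Set.range (ProjSpace.chart k x) =
      (ProjectiveSpectrum.zeroLocus (homogeneousSubmodule (Fin (n + 1)) k) {X x})ᶜ := by
  have h := congrArg (fun U : (Proj (homogeneousSubmodule (Fin (n + 1)) k)).Opens =>
    (U : Set (Proj (homogeneousSubmodule (Fin (n + 1)) k))))
    (Proj.opensRange_awayι (homogeneousSubmodule (Fin (n + 1)) k) (X x)
      (X_mem_homogeneousSubmodule x) one_pos)
  exact h.trans (ProjectiveSpectrum.basicOpen_eq_zeroLocus_compl _ _)

lemma ProjSpace.specMap_awayQuotient_comp (x : Fin (n + 1))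
    (S : Set (MvPolynomial (Fin (n + 1)) k)) :
    Spec.map (CommRingCat.ofHom (awayQuotient x S)) ≫ ProjSpace.chart k x ≫
      ProjSpace.toSpec k n = Spec.map (CommRingCat.ofHom (algebraMap k _)) := by
  change Spec.map (CommRingCat.ofHom (awayQuotient x S)) ≫
    Proj.awayι (homogeneousSubmodule (Fin (n + 1)) k) (X x) (X_mem_homogeneousSubmodule x)
      one_pos ≫ Proj.toSpecZero (homogeneousSubmodule (Fin (n + 1)) k) ≫
        Spec.map (CommRingCat.ofHom (algebraMap k _)) = _
  rw [Proj.awayι_toSpecZero_assoc, ← Spec.map_comp, ← Spec.map_comp, ← CommRingCat.ofHom_comp,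
    ← CommRingCat.ofHom_comp]
  congr 2
  ext c
  have := congrArg (fun g => g (C c)) (awayQuotient_comp_dehomogenize x S)
  rw [RingHom.comp_apply, dehomogenize, eval₂Hom_C] at this
  exact this

lemma ProjSpace.range_specMap_awayQuotient (x : Fin (n + 1))
    (S : Set (MvPolynomial (Fin (n + 1)) k)) (hS : ∀ s ∈ S, ∃ d, 0 < d ∧ s.IsHomogeneous d) :
    Set.range (Spec.map (CommRingCat.ofHom (awayQuotient x S))) =
      ProjSpace.chart k x ⁻¹'
        ProjectiveSpectrum.zeroLocus (homogeneousSubmodule (Fin (n + 1)) k) S := by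
  have h₁ : Set.range (Spec.map (CommRingCat.ofHom (awayQuotient x S))) =
      PrimeSpectrum.zeroLocus (RingHom.ker (awayQuotient x S)) :=
    range_comap_of_surjective _ _ (awayQuotient_surjective x S)
  have h₂ : ∀ {s d} (hs : s.IsHomogeneous d), 0 < d → ∀ p,
      s ∈ (ProjSpace.chart k x p : ProjectiveSpectrum _).asHomogeneousIdeal ↔
      Away.isLocalizationElem (X_mem_homogeneousSubmodule x) hs ∈ p.asIdeal := by
    intro s d hs hd p
    have := congrArg (fun U : (Spec (.of (Away (homogeneousSubmodule (Fin (n + 1)) k)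
        (X x)))).Opens => p ∈ U) (Proj.awayι_preimage_basicOpen
      (homogeneousSubmodule (Fin (n + 1)) k) (X_mem_homogeneousSubmodule x) one_pos hs hd)
    exact not_iff_not.mp (Iff.of_eq this)
  rw [h₁]
  ext p
  refine ⟨fun hp s hs => ?_, fun hp => ker_awayQuotient_le x S p.asIdeal fun s hs => ?_⟩
  · obtain ⟨d, hd, hsd⟩ := hS s hs
    exact (h₂ hsd hd p).mpr (hp (awayQuotient_isLocalizationElem x S hs hsd))
  · obtain ⟨d, hd, hsd⟩ := hS s hs
    exact ⟨d, hsd, (h₂ hsd hd p).mp (hp hs)⟩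

variable {k} {R : Type v} [CommRing R] (μ : MotivicMeasure k R)

lemma MotivicMeasure.cl_pullback_chart {Z : Scheme.{u}} (i : Z ⟶ ProjSpace k n)
    [IsClosedImmersion i] (S : Set (MvPolynomial (Fin (n + 1)) k))
    (hS : ∀ s ∈ S, ∃ d, 0 < d ∧ s.IsHomogeneous d)
    (hi : Set.range i = ProjectiveSpectrum.zeroLocus (homogeneousSubmodule (Fin (n + 1)) k) S)
    (x : Fin (n + 1)) :
    μ.cl (pullback i (ProjSpace.chart k x))
        (pullback.fst i (ProjSpace.chart k x) ≫ i ≫ ProjSpace.toSpec k n) =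
      μ.clAlg (MvPolynomial (Fin (n + 1)) k ⧸ Ideal.span (insert (X x - 1) S)) := by
  have hcl : IsClosedImmersion (Spec.map (CommRingCat.ofHom (awayQuotient x S))) :=
    .spec_of_surjective _ (awayQuotient_surjective x S)
  rw [MotivicMeasure.clAlg, ← ProjSpace.specMap_awayQuotient_comp, pullback.condition_assoc]
  refine μ.cl_eq_of_range_eq _ _ _ ?_
  rw [Scheme.Pullback.range_snd, ProjSpace.range_specMap_awayQuotient k x S hS, hi]

/-- Cutting a closed subscheme of projective space by a hyperplane. -/
lemma MotivicMeasure.cl_eq_clAlg_add {Z Z' : Scheme.{u}} (i : Z ⟶ ProjSpace k n)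
    [IsClosedImmersion i] (S : Set (MvPolynomial (Fin (n + 1)) k))
    (hS : ∀ s ∈ S, ∃ d, 0 < d ∧ s.IsHomogeneous d)
    (hi : Set.range i = ProjectiveSpectrum.zeroLocus (homogeneousSubmodule (Fin (n + 1)) k) S)
    (x : Fin (n + 1)) (i' : Z' ⟶ ProjSpace k n) [IsClosedImmersion i']
    (hi' : Set.range i' =
      ProjectiveSpectrum.zeroLocus (homogeneousSubmodule (Fin (n + 1)) k) (insert (X x) S)) :
    μ.cl Z (i ≫ ProjSpace.toSpec k n) =
      μ.clAlg (MvPolynomial (Fin (n + 1)) k ⧸ Ideal.span (insert (X x - 1) S)) +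
        μ.cl Z' (i' ≫ ProjSpace.toSpec k n) := by
  have hr : Set.range (pullback.fst i (ProjSpace.chart k x)) =
      (Set.range (pullback.fst i i'))ᶜ := by
    rw [Scheme.Pullback.range_fst, Scheme.Pullback.range_fst, ProjSpace.range_chart, hi',
      Set.insert_eq, ProjectiveSpectrum.zeroLocus_union, ← hi]
    ext z
    exact ⟨fun h h' => h h'.1, fun h h' => h ⟨h', z, rfl⟩⟩
  rw [μ.cl_eq_add _ _ _ hr, μ.cl_pullback_chart i S hS hi, pullback.condition_assoc]
  congr 1
  have hle : Set.range i' ⊆ Set.range i := by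
    rw [hi, hi']
    exact ProjectiveSpectrum.zeroLocus_anti_mono _ (Set.subset_insert _ _)
  rw [← Category.assoc]
  refine μ.cl_eq_of_range_eq _ _ _ ?_
  rw [Scheme.Pullback.range_snd_comp]
  exact Set.inter_eq_self_of_subset_right hle

end ProjectiveScheme

section Cone

attribute [local instance] MvPolynomial.gradedAlgebra
  ProjSpace.locallyOfFiniteType_toSpec ProjSpace.quasiCompact_toSpec
  ProjSpace.isSeparated_toSpec

variable {k : Type u} [Field k] {n : ℕ}

lemma exists_X_notMem_asHomogeneousIdeal
    (z : ProjectiveSpectrum (homogeneousSubmodule (Fin (n + 1)) k)) :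
    ∃ j, (X j : MvPolynomial (Fin (n + 1)) k) ∉ z.asHomogeneousIdeal := by
  have h : ⨆ j, Proj.basicOpen (homogeneousSubmodule (Fin (n + 1)) k) (X j) = ⊤ := by
    refine Proj.iSup_basicOpen_eq_top' _ _ (fun j => ⟨1, X_mem_homogeneousSubmodule j⟩) ?_
    refine top_unique fun p _ => ?_
    induction p using MvPolynomial.induction_on with
    | C c =>
      exact Subalgebra.algebraMap_mem _
        (⟨C c, isHomogeneous_C _ c⟩ : homogeneousSubmodule (Fin (n + 1)) k 0)
    | add p q hp hq => exact add_mem (hp trivial) (hq trivial)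
    | mul_X p j hp => exact mul_mem (hp trivial) (Algebra.subset_adjoin ⟨j, rfl⟩)
  have hz : z ∈ ⨆ j, Proj.basicOpen (homogeneousSubmodule (Fin (n + 1)) k) (X j) := by
    rw [h]; trivial
  exact TopologicalSpace.Opens.mem_iSup.mp hz

lemma nonempty_quotient_algEquiv_of_X_mem {σ : Type*} (S : Set (MvPolynomial σ k))
    (hS : ∀ s ∈ S, ∃ d, 0 < d ∧ s.IsHomogeneous d) (hX : ∀ j, X j ∈ S) :
    Nonempty ((MvPolynomial σ k ⧸ Ideal.span S) ≃ₐ[k] k) := by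
  have h : Ideal.span S ≤ RingHom.ker (aeval (R := k) (fun _ : σ => (0 : k))) := by
    refine Ideal.span_le.mpr fun s hs => ?_
    obtain ⟨d, hd, hsd⟩ := hS s hs
    have := hsd.aeval_mul (0 : k) (fun _ => 0)
    simp only [zero_pow hd.ne', zero_mul] at this
    exact this
  refine ⟨AlgEquiv.ofAlgHom
    (Ideal.Quotient.liftₐ (Ideal.span S) (aeval (R := k) (fun _ : σ => (0 : k))) fun a ha => h ha)
    (Algebra.ofId k _) (Subsingleton.elim _ _) ?_⟩
  refine Ideal.Quotient.algHom_ext _ (MvPolynomial.algHom_ext fun j => ?_)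
  have h₀ : Ideal.Quotient.mk (Ideal.span S) (X j) = 0 :=
    Ideal.Quotient.eq_zero_iff_mem.mpr (Ideal.subset_span (hX j))
  change Algebra.ofId k _ (aeval (R := k) (fun _ : σ => (0 : k)) (X j)) =
    Ideal.Quotient.mk (Ideal.span S) (X j)
  rw [aeval_X, map_zero, h₀]

variable {R : Type v} [CommRing R] (μ : MotivicMeasure k R)

/-- The affine cone over a projective variety `Z`, minus its vertex, has class
`[Z] (𝕃 - 1)`. -/
lemma MotivicMeasure.cl_mul_lef_sub_one (S : Set (MvPolynomial (Fin (n + 1)) k))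
    (hS : ∀ s ∈ S, ∃ d, 0 < d ∧ s.IsHomogeneous d) {Z : Scheme.{u}} (i : Z ⟶ ProjSpace k n)
    [IsClosedImmersion i]
    (hi : Set.range i = ProjectiveSpectrum.zeroLocus (homogeneousSubmodule (Fin (n + 1)) k) S) :
    μ.cl Z (i ≫ ProjSpace.toSpec k n) * (μ.lef - 1) =
      μ.clAlg (MvPolynomial (Fin (n + 1)) k ⧸ Ideal.span S) - 1 := by
  suffices ∀ (U : Finset (Fin (n + 1))) (S : Set (MvPolynomial (Fin (n + 1)) k)),
      (∀ s ∈ S, ∃ d, 0 < d ∧ s.IsHomogeneous d) → (∀ j ∉ U, X j ∈ S) →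
      ∀ {Z : Scheme.{u}} (i : Z ⟶ ProjSpace k n) [IsClosedImmersion i],
      Set.range i = ProjectiveSpectrum.zeroLocus (homogeneousSubmodule (Fin (n + 1)) k) S →
      μ.cl Z (i ≫ ProjSpace.toSpec k n) * (μ.lef - 1) =
        μ.clAlg (MvPolynomial (Fin (n + 1)) k ⧸ Ideal.span S) - 1 from
    this Finset.univ S hS (fun j hj => absurd (Finset.mem_univ j) hj) i hi
  intro U
  induction U using Finset.induction_on with
  | empty =>
    intro S hS hX Z i _ hi
    have : IsEmpty Z := ⟨fun z => by
      obtain ⟨j, hj⟩ := exists_X_notMem_asHomogeneousIdeal (i z)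
      have hz : i z ∈ Set.range i := ⟨z, rfl⟩
      rw [hi] at hz
      exact hj (hz (hX j (Finset.notMem_empty j)))⟩
    obtain ⟨e⟩ := nonempty_quotient_algEquiv_of_X_mem S hS fun j => hX j (Finset.notMem_empty j)
    rw [μ.cl_isEmpty, μ.clAlg_congr e, μ.clAlg_base, zero_mul, sub_self]
  | insert x U _ ih =>
    intro S hS hX Z i _ hi
    have hS' : ∀ s ∈ insert (X x) S, ∃ d, 0 < d ∧ s.IsHomogeneous d := by
      rintro s (rfl | hs)
      · exact ⟨1, one_pos, isHomogeneous_X k x⟩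
      · exact hS s hs
    let T : TopologicalSpace.Closeds (ProjSpace k n) :=
      ⟨ProjectiveSpectrum.zeroLocus (homogeneousSubmodule (Fin (n + 1)) k) (insert (X x) S),
        ProjectiveSpectrum.isClosed_zeroLocus _ _⟩
    let i' := (Scheme.IdealSheafData.vanishingIdeal T).subschemeι
    have hi' : Set.range i' = ProjectiveSpectrum.zeroLocus
        (homogeneousSubmodule (Fin (n + 1)) k) (insert (X x) S) := by
      rw [Scheme.IdealSheafData.range_subschemeι,
        Scheme.IdealSheafData.coe_support_vanishingIdeal]
      rfl
    have h := ih (insert (X x) S) hS' (fun j hj => by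
      by_cases hjx : j = x
      · exact hjx ▸ Set.mem_insert _ _
      · exact Set.mem_insert_of_mem _ (hX j (by simp [hj, hjx]))) i' hi'
    rw [μ.cl_eq_clAlg_add i S hS hi x i' hi', add_mul, h, ← μ.clAlg_away_X x S hS,
      μ.clAlg_quotient_eq_add (Ideal.span S) (X x), Ideal.span_insert, sup_comm, add_sub_assoc]

end Cone

/-- Let `k` be a `C1` field and let `X = V(f) ⊂ ℙⁿ_k` be a hypersurface of
degree 3 (with `3 ≤ n`).  If the singular locus of `X` contains a `k`-rational point
(a nonzero `a ∈ k^{n+1}` with `f(a) = 0` at which all partial derivatives of `f` vanish),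
then `[X] ≡ 1 mod 𝕃` in `K₀(Var_k)`. -/
theorem cubic_with_rational_singular_point_class_eq_one (k : Type u) [Field k]
    (hk : IsC1Field k) (n : ℕ) (hn : 3 ≤ n)
    (f : MvPolynomial (Fin (n + 1)) k) (hf : f.IsHomogeneous 3) (hf0 : f ≠ 0)
    (a : Fin (n + 1) → k) (ha0 : a ≠ 0) (haX : MvPolynomial.eval a f = 0)
    (hsing : ∀ i, MvPolynomial.eval a (MvPolynomial.pderiv i f) = 0)
    (X : Scheme.{u}) (sX : X ⟶ SpecBase k) (hX : IsProjSubvariety k n {f} X sX) :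
    ∀ (R : Type u) [CommRing R] (μ : MotivicMeasure k R),
      μ.cl X sX - 1 ∈ Ideal.span {μ.lef} := by
  intro R _ μ
  obtain ⟨m, rfl⟩ : ∃ m, n = m + 3 := ⟨n - 3, by omega⟩
  obtain ⟨-, i, hi, rfl, hrange⟩ := hX
  have h := μ.cl_mul_lef_sub_one {f} (by rintro s rfl; exact ⟨3, by norm_num, hf⟩) i hrange
  have hmem := μ.clAlg_singular_cubic_form_mem hk f hf a ha0 haX hsing
  have heq : μ.cl X (i ≫ ProjSpace.toSpec k (m + 3)) - 1 =
      μ.cl X (i ≫ ProjSpace.toSpec k (m + 3)) * μ.lef -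
        μ.clAlg (MvPolynomial (Fin (m + 4)) k ⧸ Ideal.span {f}) := by
    linear_combination -h
  rw [heq]
  exact sub_mem (Ideal.mul_mem_left _ _ (Ideal.mem_span_singleton_self _)) hmem
end

section
/- Let k be an algebraically closed field of characteristic zero and let X ⊂ ℙⁿ_k be the union of two quadric hypersurfaces Q₁ and Q₂, where Q₁ is smooth and n ≥ 4. Then [X] ≡ 1 mod 𝕃 in K₀(Var_k). -/
open AlgebraicGeometry CategoryTheory CategoryTheory.Limits MvPolynomial

universe u v

noncomputable section

attribute [local instance] MvPolynomial.gradedAlgebra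

end

attribute [local instance] MvPolynomial.gradedAlgebra

namespace MotivicMeasure

universe w

variable {k : Type u} [Field k] {R : Type w} [CommRing R] (μ : MotivicMeasure k R)

lemma cl_empty {X : Scheme.{u}} [IsEmpty X] (sX : X ⟶ SpecBase k) : μ.cl X sX = 0 := by
  have : IsEmpty (⊥ : X.Opens).toScheme := ⟨fun x ↦ x.2⟩
  have h := μ.cl_scissor sX (𝟙 X) inferInstance inferInstance inferInstance inferInstance ⊥
    (Subsingleton.elim _ _)
  have h' : μ.cl (⊥ : X.Opens).toScheme ((⊥ : X.Opens).ι ≫ sX) = μ.cl X sX := by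
    refine μ.cl_iso _ _ (isInitialOfIsEmpty.uniqueUpToIso isInitialOfIsEmpty)
      inferInstance inferInstance inferInstance ?_
    exact isInitialOfIsEmpty.hom_ext _ _
  rw [h', Category.id_comp] at h
  exact left_eq_add.mp h

/-- The scissor relation for an open immersion whose range is the complement of the range of a
closed immersion. -/
lemma cl_eq_add_s9 {X U Z : Scheme.{u}} (sX : X ⟶ SpecBase k) (j : U ⟶ X) (i : Z ⟶ X)
    [LocallyOfFiniteType sX] [QuasiCompact sX] [IsSeparated sX] [IsOpenImmersion j]
    [IsClosedImmersion i] [QuasiCompact j] (h : Set.range j.base = (Set.range i.base)ᶜ) :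
    μ.cl X sX = μ.cl U (j ≫ sX) + μ.cl Z (i ≫ sX) := by
  rw [μ.cl_scissor sX i inferInstance inferInstance inferInstance inferInstance j.opensRange h,
    add_left_inj]
  symm
  refine μ.cl_iso _ _ j.isoOpensRange inferInstance inferInstance inferInstance ?_
  rw [Scheme.Hom.isoOpensRange_hom_ι_assoc]

/-- The class of the spectrum of a `k`-algebra. -/
noncomputable def alg (A : Type u) [CommRing A] [Algebra k A] : R :=
  μ.cl (Spec (CommRingCat.of A)) (Spec.map (CommRingCat.ofHom (algebraMap k A)))

section Spec

variable (A : Type u) [CommRing A] [Algebra k A]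

lemma locallyOfFiniteType_algebraMap [h : Algebra.FiniteType k A] :
    LocallyOfFiniteType (Spec.map (CommRingCat.ofHom (algebraMap k A))) := by
  rw [HasRingHomProperty.Spec_iff (P := @LocallyOfFiniteType)]
  simpa [RingHom.finiteType_algebraMap] using h

variable {A}

lemma alg_congr {B : Type u} [CommRing B] [Algebra k B] [Algebra.FiniteType k A]
    (e : A ≃ₐ[k] B) : μ.alg A = μ.alg B := by
  refine μ.cl_iso _ _ (Scheme.Spec.mapIso e.toRingEquiv.toCommRingCatIso.symm.op)
    (locallyOfFiniteType_algebraMap A) inferInstance inferInstance ?_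
  simp only [Functor.mapIso_hom, Iso.op_hom, Iso.symm_hom, Scheme.Spec_map, Quiver.Hom.unop_op]
  rw [← Spec.map_comp]
  congr 1
  ext x
  simp

lemma alg_self : μ.alg k = 1 := by
  rw [← μ.cl_point, alg]
  congr 1
  exact Spec.map_id _

lemma alg_polynomial_self : μ.alg (Polynomial k) = μ.lef := rfl

lemma isClosedImmersion_quotientMk (I : Ideal A) : IsClosedImmersion
    (Spec.map (CommRingCat.ofHom (Ideal.Quotient.mk I)) :
      Spec (CommRingCat.of (A ⧸ I)) ⟶ Spec (CommRingCat.of A)) :=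
  IsClosedImmersion.spec_of_surjective _ Ideal.Quotient.mk_surjective

lemma range_quotientMk (I : Ideal A) : Set.range
    (Spec.map (CommRingCat.ofHom (Ideal.Quotient.mk I)) :
      Spec (CommRingCat.of (A ⧸ I)) ⟶ Spec (CommRingCat.of A)).base =
      PrimeSpectrum.zeroLocus (I : Set A) := by
  have := range_comap_of_surjective _ (Ideal.Quotient.mk I) Ideal.Quotient.mk_surjective
  rw [Ideal.mk_ker] at this
  exact this

lemma alg_quotient_of_le_nilradical [Algebra.FiniteType k A] (I : Ideal A)
    (hI : I ≤ nilradical A) : μ.alg (A ⧸ I) = μ.alg A := by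
  have := locallyOfFiniteType_algebraMap (k := k) A
  have := isClosedImmersion_quotientMk I
  let i : Spec (CommRingCat.of (A ⧸ I)) ⟶ Spec (CommRingCat.of A) :=
    Spec.map (CommRingCat.ofHom (Ideal.Quotient.mk I))
  have hr : Set.range i.base = Set.univ := by
    refine (range_quotientMk I).trans ?_
    exact Set.eq_univ_of_forall fun x ↦ hI.trans (nilradical_le_prime x.asIdeal)
  have h := μ.cl_eq_add_s9 (Spec.map (CommRingCat.ofHom (algebraMap k A)))
    (Scheme.emptyTo (Spec (CommRingCat.of A))) i (by
      rw [hr, Set.compl_univ]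
      exact Set.range_eq_empty _)
  rw [μ.cl_empty (X := (∅ : Scheme.{u})), zero_add] at h
  rw [alg, alg, h, ← Spec.map_comp]
  rfl

lemma alg_eq_away_add_quotient [Algebra.FiniteType k A] (f : A) :
    μ.alg A = μ.alg (Localization.Away f) + μ.alg (A ⧸ Ideal.span {f}) := by
  have := locallyOfFiniteType_algebraMap (k := k) A
  have := isClosedImmersion_quotientMk (Ideal.span {f})
  let i : Spec (CommRingCat.of (A ⧸ Ideal.span {f})) ⟶ Spec (CommRingCat.of A) :=
    Spec.map (CommRingCat.ofHom (Ideal.Quotient.mk _))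
  let j : Spec (CommRingCat.of (Localization.Away f)) ⟶ Spec (CommRingCat.of A) :=
    Spec.map (CommRingCat.ofHom (algebraMap A _))
  have : IsOpenImmersion j := by
    exact IsOpenImmersion.of_isLocalization f
  have h := μ.cl_eq_add_s9 (Spec.map (CommRingCat.ofHom (algebraMap k A))) j i (by
      refine (PrimeSpectrum.localization_away_comap_range _ f).trans ?_
      rw [range_quotientMk, PrimeSpectrum.zeroLocus_span]
      exact PrimeSpectrum.basicOpen_eq_zeroLocus_compl f)
  rw [alg, alg, alg, h, ← Spec.map_comp, ← Spec.map_comp]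
  rfl

lemma alg_tensorProduct (B : Type u) [CommRing B] [Algebra k B] [Algebra.FiniteType k A]
    [Algebra.FiniteType k B] : μ.alg (TensorProduct k A B) = μ.alg A * μ.alg B := by
  have := locallyOfFiniteType_algebraMap (k := k) A
  have := locallyOfFiniteType_algebraMap (k := k) B
  have : Algebra.FiniteType k (TensorProduct k A B) :=
    Algebra.FiniteType.trans (S := A) inferInstance (Algebra.FiniteType.baseChange A)
  rw [alg, alg, alg, ← μ.cl_prod _ _ inferInstance inferInstance inferInstance inferInstance
    inferInstance inferInstance]
  refine μ.cl_iso _ _ (pullbackSpecIso k A B).symm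
    (locallyOfFiniteType_algebraMap (TensorProduct k A B)) inferInstance inferInstance ?_
  rw [Iso.symm_hom, pullbackSpecIso_inv_fst_assoc, ← Spec.map_comp]
  rfl

instance [Algebra.FiniteType k A] : Algebra.FiniteType k (Polynomial A) :=
  Algebra.FiniteType.trans (S := A) inferInstance inferInstance

variable (A) in
lemma alg_polynomial [Algebra.FiniteType k A] :
    μ.alg (Polynomial A) = μ.lef * μ.alg A := by
  rw [μ.alg_congr ((polyEquivTensor' k A).restrictScalars k), alg_tensorProduct,
    alg_polynomial_self, mul_comm]

lemma alg_quotient_radical [Algebra.FiniteType k A] (I : Ideal A) :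
    μ.alg (A ⧸ I.radical) = μ.alg (A ⧸ I) := by
  rw [← μ.alg_quotient_of_le_nilradical (I.radical.map (Ideal.Quotient.mk I))]
  · exact (μ.alg_congr (DoubleQuot.quotQuotEquivQuotOfLEₐ k I.le_radical)).symm
  · rw [nilradical, ← Ideal.comap_le_comap_iff_of_surjective _ Ideal.Quotient.mk_surjective,
      Ideal.comap_map_of_surjective _ Ideal.Quotient.mk_surjective, Ideal.comap_radical]
    have : Ideal.comap (Ideal.Quotient.mk I) ⊥ = I := Ideal.mk_ker
    simp only [Ideal.zero_eq_bot, this, sup_le_iff, le_refl, true_and]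
    exact I.le_radical

end Spec

/-- A closed subscheme of an affine scheme has the class of the quotient by any ideal with the
same zero locus. -/
lemma cl_eq_alg_quotient {A : Type u} [CommRing A] [Algebra k A] [Algebra.FiniteType k A]
    {Z : Scheme.{u}} (sZ : Z ⟶ SpecBase k) (i : Z ⟶ Spec (CommRingCat.of A))
    [hi : IsClosedImmersion i] (hs : i ≫ Spec.map (CommRingCat.ofHom (algebraMap k A)) = sZ)
    (I : Ideal A) (hI : Set.range i.base = PrimeSpectrum.zeroLocus (I : Set A)) :
    μ.cl Z sZ = μ.alg (A ⧸ I) := by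
  have := locallyOfFiniteType_algebraMap (k := k) A
  obtain ⟨J, e, rfl⟩ := IsClosedImmersion.Spec_iff.mp hi
  have hJ : J.radical = I.radical := by
    rw [← PrimeSpectrum.zeroLocus_eq_iff, ← hI, ← range_quotientMk]
    simp [Set.range_comp]
    rfl
  rw [← alg_quotient_radical, ← hJ, alg_quotient_radical, alg]
  subst hs
  refine μ.cl_iso _ _ e inferInstance inferInstance inferInstance ?_
  rw [Category.assoc, ← Spec.map_comp]
  rfl

lemma alg_sub_alg_quotient_eq_of_algHom {A B : Type u} [CommRing A] [Algebra k A]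
    [Algebra.FiniteType k A] [CommRing B] [Algebra k B] [Algebra.FiniteType k B]
    (φ : A →ₐ[k] B) (f : A) (hs : ∀ b, ∃ n a, φ f ^ n * b = φ a)
    (hi : ∀ a, φ a = 0 → ∃ n, f ^ n * a = 0) :
    μ.alg A - μ.alg (A ⧸ Ideal.span {f}) = μ.alg B - μ.alg (B ⧸ Ideal.span {φ f}) := by
  rw [μ.alg_eq_away_add_quotient f, μ.alg_eq_away_add_quotient (φ f), add_sub_cancel_right,
    add_sub_cancel_right]
  have : Algebra.FiniteType k (Localization.Away f) :=
    Algebra.FiniteType.trans (S := A) inferInstance (IsLocalization.finiteType_of_monoid_fg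
      (Submonoid.powers f) _)
  refine μ.alg_congr (AlgEquiv.ofBijective (Localization.awayMapₐ φ f)
    ⟨Localization.awayMap_injective_iff.mpr hi, Localization.awayMap_surjective_iff.mpr
      fun b ↦ ?_⟩)
  obtain ⟨n, a, h⟩ := hs b
  exact ⟨a, n, h.symm⟩

lemma alg_quotient_quotient {P : Type u} [CommRing P] [Algebra k P] [Algebra.FiniteType k P]
    (I : Ideal P) (f : P) :
    μ.alg ((P ⧸ I) ⧸ Ideal.span {Ideal.Quotient.mk I f}) = μ.alg (P ⧸ I ⊔ Ideal.span {f}) := by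
  rw [← Set.image_singleton, ← Ideal.map_span]
  exact μ.alg_congr (DoubleQuot.quotQuotEquivQuotSupₐ k I (Ideal.span {f}))

/-- Two locally closed subsets `{I = 0, f ≠ 0}` and `{J = 0, φ f ≠ 0}` that are identified by a
homomorphism `φ` have the same class. -/
lemma alg_quotient_sub_eq {P Q : Type u} [CommRing P] [Algebra k P]
    [Algebra.FiniteType k P] [CommRing Q] [Algebra k Q] [Algebra.FiniteType k Q]
    (I : Ideal P) (J : Ideal Q) (φ : P →ₐ[k] Q) (f : P) (hle : ∀ p ∈ I, φ p ∈ J)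
    (hs : ∀ q, ∃ n p, φ f ^ n * q - φ p ∈ J) (hi : ∀ p, φ p ∈ J → ∃ n, f ^ n * p ∈ I) :
    μ.alg (P ⧸ I) - μ.alg (P ⧸ I ⊔ Ideal.span {f}) =
      μ.alg (Q ⧸ J) - μ.alg (Q ⧸ J ⊔ Ideal.span {φ f}) := by
  have h := μ.alg_sub_alg_quotient_eq_of_algHom (Ideal.quotientMapₐ J φ hle)
    (Ideal.Quotient.mk I f) (fun b ↦ ?_) (fun a ha ↦ ?_)
  · have hf : Ideal.quotientMapₐ J φ hle (Ideal.Quotient.mk I f) = Ideal.Quotient.mk J (φ f) := rfl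
    rw [hf, alg_quotient_quotient, alg_quotient_quotient] at h
    exact h
  · obtain ⟨q, rfl⟩ := Ideal.Quotient.mk_surjective b
    obtain ⟨n, p, h⟩ := hs q
    refine ⟨n, Ideal.Quotient.mk I p, ?_⟩
    rw [← Ideal.Quotient.eq, map_mul, map_pow] at h
    exact h
  · obtain ⟨p, rfl⟩ := Ideal.Quotient.mk_surjective a
    obtain ⟨n, h⟩ := hi p (Ideal.Quotient.eq_zero_iff_mem.mp ha)
    refine ⟨n, ?_⟩
    rw [← map_pow, ← map_mul]
    exact Ideal.Quotient.eq_zero_iff_mem.mpr h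

lemma alg_quotient_map_C {P : Type u} [CommRing P] [Algebra k P] [Algebra.FiniteType k P]
    (I : Ideal P) : μ.alg (Polynomial P ⧸ I.map Polynomial.C) = μ.lef * μ.alg (P ⧸ I) := by
  rw [← alg_polynomial]
  refine (μ.alg_congr (AlgEquiv.ofRingEquiv
    (f := Ideal.polynomialQuotientEquivQuotientPolynomial I) fun r ↦ ?_)).symm
  rw [IsScalarTower.algebraMap_apply k (P ⧸ I) (Polynomial (P ⧸ I)), Polynomial.algebraMap_eq,
    ← Ideal.Quotient.mk_algebraMap, ← Polynomial.map_C,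
    Ideal.polynomialQuotientEquivQuotientPolynomial_map_mk]
  rfl

lemma alg_quotient_congr {P Q : Type u} [CommRing P] [Algebra k P]
    [Algebra.FiniteType k P] [CommRing Q] [Algebra k Q] (e : P ≃ₐ[k] Q) (I : Ideal P) (J : Ideal Q)
    (h : J = I.map (e : P →+* Q)) : μ.alg (P ⧸ I) = μ.alg (Q ⧸ J) :=
  μ.alg_congr (Ideal.quotientEquivAlg I J e h)

lemma alg_quotient_of_eq {P : Type u} [CommRing P] [Algebra k P] {I J : Ideal P} (h : I = J) :
    μ.alg (P ⧸ I) = μ.alg (P ⧸ J) := by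
  rw [h]

end MotivicMeasure

/-- The elements `q` such that a multiple `φ f ^ n * q` lies in the range of `φ` modulo `J`. -/
def rangeUpToPow {P Q : Type*} [CommRing P] [CommRing Q] (φ : P →+* Q) (f : P) (J : Ideal Q) :
    Subring Q where
  carrier := {q | ∃ n p, φ f ^ n * q - φ p ∈ J}
  one_mem' := ⟨0, 1, by simp⟩
  zero_mem' := ⟨0, 0, by simp⟩
  neg_mem' := by
    rintro q ⟨n, p, h⟩
    refine ⟨n, -p, ?_⟩
    rw [map_neg, ← neg_mem_iff]
    convert h using 1
    ring
  add_mem' := by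
    rintro q q' ⟨n, p, h⟩ ⟨n', p', h'⟩
    refine ⟨n + n', f ^ n' * p + f ^ n * p', ?_⟩
    convert J.add_mem (J.mul_mem_left (φ f ^ n') h) (J.mul_mem_left (φ f ^ n) h') using 1
    simp only [map_add, map_mul, map_pow]
    ring
  mul_mem' := by
    rintro q q' ⟨n, p, h⟩ ⟨n', p', h'⟩
    refine ⟨n + n', p * p', ?_⟩
    convert J.add_mem (J.mul_mem_left (φ f ^ n' * q') h) (J.mul_mem_left (φ p) h') using 1
    simp only [map_mul]
    ring

lemma map_mem_rangeUpToPow {P Q : Type*} [CommRing P] [CommRing Q] (φ : P →+* Q) (f : P)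
    (J : Ideal Q) (p : P) : φ p ∈ rangeUpToPow φ f J :=
  ⟨0, p, by simp⟩

lemma Ideal.exists_pow_mul_mem_of_localization_eq_zero {P : Type*} [CommRing P] (I : Ideal P)
    (f p : P)
    (h : algebraMap (P ⧸ I) (Localization.Away (Ideal.Quotient.mk I f))
      (Ideal.Quotient.mk I p) = 0) :
    ∃ n, f ^ n * p ∈ I := by
  obtain ⟨⟨_, n, rfl⟩, hn⟩ := (IsLocalization.map_eq_zero_iff
    (Submonoid.powers (Ideal.Quotient.mk I f)) _ _).mp h
  refine ⟨n, Ideal.Quotient.eq_zero_iff_mem.mp ?_⟩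
  rw [map_mul, map_pow]
  exact hn

namespace MotivicMeasure

universe w

variable {k : Type u} [Field k] {R : Type w} [CommRing R] (μ : MotivicMeasure k R)

variable {P : Type u} [CommRing P] [Algebra k P] [Algebra.FiniteType k P]

/-- The locus `f ≠ 0` in `{I = 0}` has the class of the graph of the function `s / f`. -/
lemma alg_quotient_sub_eq_graph (I : Ideal P) (f s : P) (T : Set (Polynomial P))
    (hI : ∀ p ∈ I, Polynomial.C p ∈ Ideal.span T)
    (hs : Polynomial.C f * Polynomial.X - Polynomial.C s ∈ Ideal.span T)
    (hT : ∀ t ∈ T, ∃ a b, t = Polynomial.C a * Polynomial.X + Polynomial.C b ∧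
      a * s + b * f ∈ I) :
    μ.alg (P ⧸ I) - μ.alg (P ⧸ I ⊔ Ideal.span {f}) = μ.alg (Polynomial P ⧸ Ideal.span T) -
      μ.alg (Polynomial P ⧸ Ideal.span T ⊔ Ideal.span {Polynomial.C f}) := by
  refine μ.alg_quotient_sub_eq I (Ideal.span T) (IsScalarTower.toAlgHom k P (Polynomial P)) f hI
    (fun q ↦ ?_) (fun p hp ↦ ?_)
  · suffices q ∈ rangeUpToPow Polynomial.C f (Ideal.span T) from this
    have hX : Polynomial.X ∈ rangeUpToPow Polynomial.C f (Ideal.span T) :=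
      ⟨1, s, by simpa using hs⟩
    induction q using Polynomial.induction_on' with
    | add p q hp hq => exact add_mem hp hq
    | monomial n a =>
      rw [← Polynomial.C_mul_X_pow_eq_monomial]
      exact mul_mem (map_mem_rangeUpToPow ..) (pow_mem hX n)
  · refine I.exists_pow_mul_mem_of_localization_eq_zero f p ?_
    let S := Localization.Away (Ideal.Quotient.mk I f)
    let ρ : P →+* S := (algebraMap (P ⧸ I) S).comp (Ideal.Quotient.mk I)
    obtain ⟨g, hg⟩ : ∃ g, ρ f * g = 1 := (IsLocalization.map_units S
      (⟨_, Submonoid.mem_powers _⟩ : Submonoid.powers (Ideal.Quotient.mk I f))).exists_right_inv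
    have hle : Ideal.span T ≤ RingHom.ker (Polynomial.eval₂RingHom ρ (ρ s * g)) := by
      refine Ideal.span_le.mpr fun t ht ↦ ?_
      obtain ⟨a, b, rfl, hab⟩ := hT t ht
      have h0 : ρ (a * s + b * f) = 0 := by
        rw [RingHom.comp_apply, Ideal.Quotient.eq_zero_iff_mem.mpr hab, map_zero]
      simp only [map_add, map_mul] at h0
      simp only [SetLike.mem_coe, RingHom.mem_ker, Polynomial.coe_eval₂RingHom,
        Polynomial.eval₂_add, Polynomial.eval₂_mul, Polynomial.eval₂_C, Polynomial.eval₂_X]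
      linear_combination g * h0 - ρ b * hg
    have h := hle hp
    rw [RingHom.mem_ker] at h
    have hp0 : ρ p = 0 := by simpa using h
    exact hp0

/-- The class of the family of affine subspaces of the line given by `ℓ * x + r = 0`, modulo `𝕃`. -/
lemma alg_quotient_linear (hL : μ.lef = 0) (I : Ideal P) (l r : P) :
    μ.alg (Polynomial P ⧸ I.map Polynomial.C ⊔
      Ideal.span {Polynomial.C l * Polynomial.X + Polynomial.C r}) =
      μ.alg (P ⧸ I) - μ.alg (P ⧸ I ⊔ Ideal.span {l}) := by
  have h := μ.alg_quotient_sub_eq_graph I l (-r)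
    (Polynomial.C '' I ∪ {Polynomial.C l * Polynomial.X + Polynomial.C r})
    (fun p hp ↦ Ideal.subset_span (Or.inl ⟨p, hp, rfl⟩))
    (Ideal.subset_span (Or.inr (by simp))) (by
      rintro t (⟨p, hp, rfl⟩ | rfl)
      · exact ⟨0, p, by simp, by simpa using I.mul_mem_right _ hp⟩
      · exact ⟨l, r, rfl, by convert I.zero_mem using 1; ring⟩)
  rw [h, Ideal.span_union, ← Ideal.map]
  refine (sub_eq_self.mpr ?_).symm
  have h' := μ.alg_quotient_map_C (I ⊔ Ideal.span {l} ⊔ Ideal.span {r})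
  rw [hL, zero_mul] at h'
  rw [← h']
  refine alg_quotient_of_eq _ ?_
  simp only [Ideal.map_sup, Ideal.map_span, Set.image_singleton]
  rw [sup_assoc, sup_assoc, ← Ideal.span_union, ← Ideal.span_union]
  congr 1
  refine le_antisymm ?_ ?_ <;> rw [Ideal.span_le] <;> rintro _ (rfl | rfl)
  · exact add_mem (Ideal.mul_mem_right _ _ (Ideal.subset_span (by simp)))
      (Ideal.subset_span (by simp))
  · exact Ideal.subset_span (by simp)
  · exact Ideal.subset_span (by simp)
  · have h1 : Polynomial.C l * Polynomial.X + Polynomial.C r ∈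
      Ideal.span ({Polynomial.C l * Polynomial.X + Polynomial.C r} ∪ {Polynomial.C l}) :=
      Ideal.subset_span (by simp)
    have h2 : Polynomial.C l ∈
      Ideal.span ({Polynomial.C l * Polynomial.X + Polynomial.C r} ∪ {Polynomial.C l}) :=
      Ideal.subset_span (by simp)
    rw [SetLike.mem_coe]
    convert sub_mem h1 (Ideal.mul_mem_right Polynomial.X _ h2) using 1
    ring

/-- Two equations of degree one in one variable, modulo `𝕃`. -/
lemma alg_quotient_linear_pair (hL : μ.lef = 0) (l₁ l₂ r₁ r₂ : P) :
    μ.alg (Polynomial P ⧸ Ideal.span {Polynomial.C l₁ * Polynomial.X + Polynomial.C r₁,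
      Polynomial.C l₂ * Polynomial.X + Polynomial.C r₂}) =
    μ.alg (Polynomial P ⧸ Ideal.span {Polynomial.C l₂ - Polynomial.C l₁ * Polynomial.X,
      Polynomial.C r₂ - Polynomial.C r₁ * Polynomial.X}) + μ.alg (P ⧸ Ideal.span {l₁, r₁}) -
      μ.alg (P ⧸ Ideal.span {l₁, l₂}) := by
  have h₁ := μ.alg_quotient_sub_eq_graph (Ideal.span {l₁ * r₂ - l₂ * r₁}) l₁ (-r₁)
    {Polynomial.C l₁ * Polynomial.X + Polynomial.C r₁,
      Polynomial.C l₂ * Polynomial.X + Polynomial.C r₂} (by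
      intro p hp
      obtain ⟨c, rfl⟩ := Ideal.mem_span_singleton.mp hp
      refine Ideal.mem_span_pair.mpr ⟨-Polynomial.C (l₂ * c), Polynomial.C (l₁ * c), ?_⟩
      simp only [map_sub, map_mul]
      ring)
    (Ideal.subset_span (by simp)) (by
      rintro t (rfl | rfl)
      · exact ⟨l₁, r₁, rfl, by convert Ideal.zero_mem _ using 1; ring⟩
      · exact ⟨l₂, r₂, rfl, Ideal.mem_span_singleton.mpr ⟨1, by ring⟩⟩)
  have h₂ := μ.alg_quotient_sub_eq_graph (Ideal.span {l₁ * r₂ - l₂ * r₁}) l₁ l₂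
    {Polynomial.C l₂ - Polynomial.C l₁ * Polynomial.X,
      Polynomial.C r₂ - Polynomial.C r₁ * Polynomial.X} (by
      intro p hp
      obtain ⟨c, rfl⟩ := Ideal.mem_span_singleton.mp hp
      refine Ideal.mem_span_pair.mpr ⟨-Polynomial.C (r₁ * c), Polynomial.C (l₁ * c), ?_⟩
      simp only [map_sub, map_mul]
      ring)
    (by rw [← neg_mem_iff]; exact Ideal.subset_span (by simp)) (by
      rintro t (rfl | rfl)
      · exact ⟨-l₁, l₂, by simp only [map_neg]; ring, by convert Ideal.zero_mem _ using 1; ring⟩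
      · exact ⟨-r₁, r₂, by simp only [map_neg]; ring, Ideal.mem_span_singleton.mpr ⟨1, by ring⟩⟩)
  have h₃ := μ.alg_quotient_linear hL (Ideal.span {l₁, r₁}) l₂ r₂
  have h₄ := μ.alg_quotient_linear hL (Ideal.span {l₁, l₂}) (-r₁) r₂
  have e₃ : Ideal.span {Polynomial.C l₁ * Polynomial.X + Polynomial.C r₁,
      Polynomial.C l₂ * Polynomial.X + Polynomial.C r₂} ⊔ Ideal.span {Polynomial.C l₁} =
      (Ideal.span {l₁, r₁}).map Polynomial.C ⊔
        Ideal.span {Polynomial.C l₂ * Polynomial.X + Polynomial.C r₂} := by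
    rw [Ideal.map_span, ← Ideal.span_union, ← Ideal.span_union, Set.image_pair]
    refine le_antisymm ?_ ?_ <;> rw [Ideal.span_le]
    · rintro _ ((rfl | rfl) | rfl)
      · exact add_mem (Ideal.mul_mem_right _ _ (Ideal.subset_span (by simp)))
          (Ideal.subset_span (by simp))
      · exact Ideal.subset_span (by simp)
      · exact Ideal.subset_span (by simp)
    · rintro _ ((rfl | rfl) | rfl)
      · exact Ideal.subset_span (by simp)
      · rw [SetLike.mem_coe, ← add_sub_cancel_left (Polynomial.C l₁ * Polynomial.X)
          (Polynomial.C r₁)]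
        exact sub_mem (Ideal.subset_span (by simp))
          (Ideal.mul_mem_right _ _ (Ideal.subset_span (by simp)))
      · exact Ideal.subset_span (by simp)
  have e₄ : Ideal.span {Polynomial.C l₂ - Polynomial.C l₁ * Polynomial.X,
      Polynomial.C r₂ - Polynomial.C r₁ * Polynomial.X} ⊔ Ideal.span {Polynomial.C l₁} =
      (Ideal.span {l₁, l₂}).map Polynomial.C ⊔
        Ideal.span {Polynomial.C (-r₁) * Polynomial.X + Polynomial.C r₂} := by
    have e : Polynomial.C (-r₁) * Polynomial.X + Polynomial.C r₂ =
      Polynomial.C r₂ - Polynomial.C r₁ * Polynomial.X := by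
      rw [map_neg]
      ring
    rw [e, Ideal.map_span, ← Ideal.span_union, ← Ideal.span_union, Set.image_pair]
    refine le_antisymm ?_ ?_ <;> rw [Ideal.span_le]
    · rintro _ ((rfl | rfl) | rfl)
      · exact sub_mem (Ideal.subset_span (by simp))
          (Ideal.mul_mem_right _ _ (Ideal.subset_span (by simp)))
      · exact Ideal.subset_span (by simp)
      · exact Ideal.subset_span (by simp)
    · rintro _ ((rfl | rfl) | rfl)
      · exact Ideal.subset_span (by simp)
      · rw [SetLike.mem_coe, ← sub_add_cancel (Polynomial.C l₂) (Polynomial.C l₁ * Polynomial.X)]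
        exact add_mem (Ideal.subset_span (by simp))
          (Ideal.mul_mem_right _ _ (Ideal.subset_span (by simp)))
      · exact Ideal.subset_span (by simp)
  have e₅ : Ideal.span {l₁, r₁} ⊔ Ideal.span {l₂} = Ideal.span {l₁, l₂} ⊔ Ideal.span {-r₁} := by
    rw [Ideal.span_singleton_neg, Ideal.span_insert, Ideal.span_insert l₁ {l₂}, sup_right_comm]
  rw [alg_quotient_of_eq μ e₃, h₃, alg_quotient_of_eq μ e₅] at h₁
  rw [alg_quotient_of_eq μ e₄, h₄] at h₂
  linear_combination h₂ - h₁

end MotivicMeasure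

namespace MvPolynomial

lemma IsHomogeneous.eval_zero_eq_zero {k σ : Type*} [CommSemiring k] {p : MvPolynomial σ k} {d : ℕ}
    (hp : p.IsHomogeneous d) (hd : d ≠ 0) : eval 0 p = 0 := by
  rw [eval_zero, constantCoeff_eq]
  exact hp.coeff_eq_zero (by simpa using hd.symm)

/-- Fewer homogeneous forms than variables have a nontrivial common zero. -/
lemma exists_ne_zero_forall_eval_eq_zero {k σ ι : Type*} [Field k] [IsAlgClosed k] [Finite σ]
    [Finite ι] (f : ι → MvPolynomial σ k) (d : ι → ℕ) (hd : ∀ i, d i ≠ 0)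
    (hf : ∀ i, (f i).IsHomogeneous (d i)) (hlt : Nat.card ι < Nat.card σ) :
    ∃ v : σ → k, v ≠ 0 ∧ ∀ i, eval v (f i) = 0 := by
  by_contra! h
  obtain ⟨M, hM, hht⟩ :
      ∃ M : Ideal (MvPolynomial σ k), M.IsMaximal ∧ (Nat.card ι : ℕ∞) < M.height := by
    by_contra! hle
    have hdim := MvPolynomial.ringKrullDim_of_isNoetherianRing (R := k) (ι := σ)
    rw [ringKrullDim_eq_zero_of_field, zero_add] at hdim
    have hdim' : ringKrullDim (MvPolynomial σ k) ≤ (Nat.card ι : ℕ∞) := by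
      rw [← Ideal.sup_isMaximal_height_eq_ringKrullDim]
      exact WithBot.coe_le_coe.mpr (iSup₂_le fun I hI ↦ hle I hI)
    rw [hdim] at hdim'
    have : Nat.card σ ≤ Nat.card ι := by exact_mod_cast hdim'
    omega
  obtain ⟨a, rfl⟩ := isMaximal_iff_eq_vanishingIdeal_singleton.mp hM
  let g : ι → MvPolynomial σ k := fun i ↦ aeval (fun j ↦ X j - C (a j)) (f i)
  have hg (x : σ → k) (i : ι) : eval x (g i) = eval (x - a) (f i) := by
    change eval x (eval₂ C _ (f i)) = _
    rw [eval_eval₂]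
    have : (eval x).comp C = RingHom.id k := by ext; simp
    rw [this]
    have h' : (fun n ↦ eval x (X n - C (a n))) = x - a := by
      ext
      simp
    rw [h']
    rfl
  have hz : zeroLocus k (Ideal.span (Set.range g)) = {a} := by
    ext x
    have haev (i : ι) : aeval x (g i) = eval (x - a) (f i) := by rw [← hg, ← coe_aeval_eq_eval]; rfl
    simp only [zeroLocus_span, Set.forall_mem_range, Set.mem_ofPred_eq, haev,
      Set.mem_singleton_iff]
    refine ⟨fun hx ↦ ?_, ?_⟩
    · by_contra hne
      obtain ⟨i, hi⟩ := h (x - a) (sub_ne_zero.mpr hne)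
      exact hi (hx i)
    · rintro rfl i
      rw [sub_self, (hf i).eval_zero_eq_zero (hd i)]
  have hrad := vanishingIdeal_zeroLocus_eq_radical (k := k) (K := k) (Ideal.span (Set.range g))
  rw [hz] at hrad
  have hle := Ideal.height_le_card_of_mem_minimalPrimes_span (p := vanishingIdeal k {a})
    (Set.finite_range g) (by
      rw [← Ideal.radical_minimalPrimes, ← hrad, Ideal.minimalPrimes_eq_subsingleton_self]
      rfl)
  refine (hht.trans_le hle).not_ge ?_
  rw [← Set.image_univ, ← Set.ncard_univ]
  exact_mod_cast Set.ncard_image_le Set.finite_univ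

/-- The polynomials of degree at most `n` whose coefficients are forms of degree `d`. -/
def formCoeff (τ k : Type*) [CommRing k] (d n : ℕ) :
    AddSubmonoid (Polynomial (MvPolynomial τ k)) where
  carrier := {p | (∀ m, (p.coeff m).IsHomogeneous d) ∧ p.natDegree ≤ n}
  zero_mem' := ⟨fun m ↦ by simpa using isHomogeneous_zero _ _ _, by simp⟩
  add_mem' := by
    rintro p q ⟨hp, hp'⟩ ⟨hq, hq'⟩
    exact ⟨fun m ↦ by simpa using (hp m).add (hq m),
      (Polynomial.natDegree_add_le_of_le hp' hq').trans (max_self n).le⟩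

section formCoeff

variable {τ k : Type*} [CommRing k]

lemma mul_mem_formCoeff {d n d' n' : ℕ} {p q : Polynomial (MvPolynomial τ k)}
    (hp : p ∈ formCoeff τ k d n) (hq : q ∈ formCoeff τ k d' n') :
    p * q ∈ formCoeff τ k (d + d') (n + n') := by
  refine ⟨fun m ↦ ?_, Polynomial.natDegree_mul_le_of_le hp.2 hq.2⟩
  rw [Polynomial.coeff_mul]
  exact IsHomogeneous.sum _ _ _ fun x _ ↦ (hp.1 _).mul (hq.1 _)

lemma map_C_mem_formCoeff (p : Polynomial k) {n : ℕ} (hp : p.natDegree ≤ n) :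
    p.map (C : k →+* MvPolynomial τ k) ∈ formCoeff τ k 0 n :=
  ⟨fun m ↦ by rw [Polynomial.coeff_map]; exact isHomogeneous_C _ _,
    Polynomial.natDegree_map_le.trans hp⟩

lemma one_mem_formCoeff : (1 : Polynomial (MvPolynomial τ k)) ∈ formCoeff τ k 0 0 := by
  simpa using map_C_mem_formCoeff (τ := τ) (1 : Polynomial k) (n := 0) (by simp)

lemma pow_mem_formCoeff {d n : ℕ} {p : Polynomial (MvPolynomial τ k)}
    (hp : p ∈ formCoeff τ k d n) (m : ℕ) : p ^ m ∈ formCoeff τ k (m * d) (m * n) := by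
  induction m with
  | zero => simpa using one_mem_formCoeff (τ := τ) (k := k)
  | succ m ih =>
    rw [pow_succ, add_one_mul, add_one_mul]
    exact mul_mem_formCoeff ih hp

lemma prod_pow_mem_formCoeff {σ : Type*} {n : ℕ} {w : σ → Polynomial (MvPolynomial τ k)}
    (hw : ∀ j, w j ∈ formCoeff τ k 1 n) (α : σ →₀ ℕ) :
    (α.prod fun j a ↦ w j ^ a) ∈ formCoeff τ k α.degree (α.degree * n) := by
  classical
  rw [Finsupp.prod, Finsupp.degree_apply]
  induction α.support using Finset.induction_on with
  | empty => simpa using one_mem_formCoeff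
  | insert j s hj ih =>
    rw [Finset.prod_insert hj, Finset.sum_insert hj, add_mul]
    exact mul_mem_formCoeff (by simpa using pow_mem_formCoeff (hw j) (α j)) ih

lemma eval₂_mem_formCoeff {σ : Type*} {n e d : ℕ} {w : σ → Polynomial (MvPolynomial τ k)}
    (hw : ∀ j, w j ∈ formCoeff τ k 1 n) (f : MvPolynomial σ (Polynomial k))
    (hf : f.IsHomogeneous d) (he : ∀ α, (f.coeff α).natDegree ≤ e) :
    f.eval₂ (Polynomial.mapRingHom C) w ∈ formCoeff τ k d (e + d * n) := by
  rw [eval₂_eq]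
  refine sum_mem fun α hα ↦ ?_
  have h : α.degree = d := by
    rw [Finsupp.degree_eq_weight_one]
    exact hf (mem_support_iff.mp hα)
  have := mul_mem_formCoeff (map_C_mem_formCoeff (τ := τ) (f.coeff α) (he α))
    (prod_pow_mem_formCoeff hw α)
  rw [zero_add, h] at this
  exact this

end formCoeff

/-- The theorem of Tsen: a system of forms over `k[t]` in sufficiently many variables has a
nontrivial zero. -/
lemma exists_ne_zero_forall_eval_eq_zero_polynomial {k σ ι : Type*} [Field k] [IsAlgClosed k]
    [Finite σ] [Finite ι] (f : ι → MvPolynomial σ (Polynomial k)) (d : ι → ℕ) (hd : ∀ i, d i ≠ 0)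
    (hf : ∀ i, (f i).IsHomogeneous (d i)) (hlt : ∑ᶠ i, d i < Nat.card σ) :
    ∃ v : σ → Polynomial k, v ≠ 0 ∧ ∀ i, eval v (f i) = 0 := by
  have := Fintype.ofFinite σ
  have := Fintype.ofFinite ι
  obtain ⟨e, he⟩ : ∃ e, ∀ i α, ((f i).coeff α).natDegree ≤ e := by
    refine ⟨Finset.univ.sup fun i ↦ (f i).support.sup fun α ↦ ((f i).coeff α).natDegree,
      fun i α ↦ ?_⟩
    by_cases hα : α ∈ (f i).support
    · exact (Finset.le_sup (f := fun α ↦ ((f i).coeff α).natDegree) hα).trans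
        (Finset.le_sup (f := fun i ↦ (f i).support.sup fun α ↦ ((f i).coeff α).natDegree)
          (Finset.mem_univ i))
    · simp [notMem_support_iff.mp hα]
  let s := Nat.card ι * (e + 1)
  let τ := σ × Fin (s + 1)
  let w : σ → Polynomial (MvPolynomial τ k) :=
    fun j ↦ ∑ a : Fin (s + 1), Polynomial.monomial a (X (j, a))
  have hw (j : σ) : w j ∈ formCoeff τ k 1 s := by
    refine sum_mem fun a _ ↦ ⟨fun m ↦ ?_, (Polynomial.natDegree_monomial_le _).trans (by omega)⟩
    rw [Polynomial.coeff_monomial]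
    split_ifs
    · exact isHomogeneous_X _ _
    · exact isHomogeneous_zero _ _ _
  let F (i : ι) := (f i).eval₂ (Polynomial.mapRingHom C) w
  have hF (i : ι) : F i ∈ formCoeff τ k (d i) (e + d i * s) :=
    eval₂_mem_formCoeff hw (f i) (hf i) (he i)
  obtain ⟨u, hu, hu'⟩ := exists_ne_zero_forall_eval_eq_zero
    (fun x : Σ i, Fin (e + d i * s + 1) ↦ (F x.1).coeff x.2) (fun x ↦ d x.1) (fun x ↦ hd x.1)
    (fun x ↦ (hF x.1).1 _) (by
      rw [finsum_eq_sum_of_fintype] at hlt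
      have h1 : ∑ i, (e + d i * s + 1) = s + (∑ i, d i) * s := by
        rw [Finset.sum_mul]
        simp only [Finset.sum_add_distrib, Finset.sum_const, s, Nat.card_eq_fintype_card,
          Finset.card_univ]
        simp only [smul_eq_mul]
        ring
      simp only [Nat.card_eq_fintype_card, Fintype.card_sigma, Fintype.card_fin, τ,
        Fintype.card_prod] at hlt ⊢
      rw [h1]
      have h2 := Nat.mul_le_mul_right (s + 1) hlt
      rw [Nat.succ_eq_add_one, add_one_mul, mul_add_one] at h2
      omega)
  refine ⟨fun j ↦ (w j).map (eval u), fun h ↦ hu ?_, fun i ↦ ?_⟩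
  · ext ⟨j, a⟩
    have h' := congr_arg (Polynomial.coeff · a) (congr_fun h j)
    simpa [w, Polynomial.coeff_monomial, Fin.val_inj] using h'
  · have h0 : (F i).map (eval u) = 0 := by
      ext m
      rw [Polynomial.coeff_map]
      by_cases hm : m < e + d i * s + 1
      · simpa using hu' ⟨i, ⟨m, hm⟩⟩
      · rw [Polynomial.coeff_eq_zero_of_natDegree_lt (by have := (hF i).2; omega)]
        simp
    rw [← h0]
    change _ = Polynomial.mapRingHom (eval u) (eval₂ _ _ _)
    rw [eval₂_comp_left, Polynomial.mapRingHom_comp]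
    have hC : (eval u).comp C = RingHom.id k := by ext; simp
    rw [hC, Polynomial.mapRingHom_id]
    rfl

end MvPolynomial

/-- Over a principal ideal domain, a nonzero vector is a multiple of a vector of a basis. -/
lemma Module.exists_basis_smul_eq {D M ι : Type*} [CommRing D] [IsDomain D]
    [IsPrincipalIdealRing D] [AddCommGroup M] [Module D M] [Finite ι] (b : Module.Basis ι D M)
    (i₀ : ι) (v : M) (hv : v ≠ 0) :
    ∃ (b' : Module.Basis ι D M) (c : D), v = c • b' i₀ := by
  classical
  obtain ⟨n, snf⟩ := Submodule.smithNormalForm b (Submodule.span D {v})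
  have hn : n ≤ 1 := by
    have h := finrank_span_le_card (R := D) ({v} : Set M)
    rw [Module.finrank_eq_card_basis snf.bN, Fintype.card_fin] at h
    simpa using h
  have hn' : n ≠ 0 := by
    rintro rfl
    have h := snf.bN.sum_repr ⟨v, Submodule.mem_span_singleton_self v⟩
    rw [Finset.univ_eq_empty, Finset.sum_empty] at h
    exact hv (congr_arg Subtype.val h).symm
  obtain rfl : n = 1 := by omega
  refine ⟨snf.bM.reindex (Equiv.swap (snf.f 0) i₀),
    snf.bN.repr ⟨v, Submodule.mem_span_singleton_self v⟩ 0 * snf.a 0, ?_⟩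
  have h := congr_arg Subtype.val (snf.bN.sum_repr ⟨v, Submodule.mem_span_singleton_self v⟩)
  simp only [Finset.univ_unique, Fin.default_eq_zero, Finset.sum_singleton, Submodule.coe_smul,
    snf.snf] at h
  simp [mul_smul, h]

namespace MvPolynomial

/-- The linear change of coordinates with a given matrix. -/
noncomputable def linearChange {D ι : Type*} [CommRing D] [Fintype ι] [DecidableEq ι]
    (A B : Matrix ι ι D) (hAB : A * B = 1) : MvPolynomial ι D ≃ₐ[D] MvPolynomial ι D :=
  AlgEquiv.ofAlgHom (bind₁ A.toMvPolynomial) (bind₁ B.toMvPolynomial)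
    (by
      ext i : 1
      have h := mul_eq_one_comm.mp hAB
      rw [AlgHom.comp_apply, bind₁_X_right, ← Matrix.toMvPolynomial_mul, h]
      simp)
    (by
      ext i : 1
      rw [AlgHom.comp_apply, bind₁_X_right, ← Matrix.toMvPolynomial_mul, hAB]
      simp)

lemma eval_linearChange {D ι : Type*} [CommRing D] [Fintype ι] [DecidableEq ι]
    (A B : Matrix ι ι D) (hAB : A * B = 1) (f : MvPolynomial ι D) (v : ι → D) :
    eval v (linearChange A B hAB f) = eval (A.mulVec v) f := by
  have h : A.mulVec v = fun i ↦ eval v (A.toMvPolynomial i) := by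
    ext i
    rw [Matrix.toMvPolynomial_eval_eq_apply]
  rw [h]
  exact eval₂Hom_bind₁ _ _ _ _

lemma IsHomogeneous.linearChange {D ι : Type*} [CommRing D] [Fintype ι] [DecidableEq ι]
    (A B : Matrix ι ι D) (hAB : A * B = 1) {f : MvPolynomial ι D} {d : ℕ} (hf : f.IsHomogeneous d) :
    (linearChange A B hAB f).IsHomogeneous d := by
  rw [← one_mul d]
  exact IsHomogeneous.aeval hf A.toMvPolynomial A.toMvPolynomial_isHomogeneous

lemma IsHomogeneous.eval_smul {D ι : Type*} [CommRing D] {f : MvPolynomial ι D} {d : ℕ}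
    (hf : f.IsHomogeneous d) (c : D) (v : ι → D) : eval (c • v) f = c ^ d * eval v f := by
  rw [eval_eq, eval_eq, Finset.mul_sum]
  refine Finset.sum_congr rfl fun α hα ↦ ?_
  have h : ∑ i ∈ α.support, α i = d := by
    rw [← Finsupp.degree_apply, Finsupp.degree_eq_weight_one]
    exact hf (mem_support_iff.mp hα)
  simp only [Pi.smul_apply, smul_eq_mul, mul_pow, Finset.prod_mul_distrib]
  rw [Finset.prod_pow_eq_pow_sum, h]
  ring

/-- A nontrivial zero of a system of forms can be moved to the first basis vector. -/
lemma exists_algEquiv_eval_single_eq_zero {D ι : Type*} [CommRing D] [IsDomain D]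
    [IsPrincipalIdealRing D] [Fintype ι] [DecidableEq ι] (i₀ : ι) (v : ι → D) (hv : v ≠ 0) :
    ∃ e : MvPolynomial ι D ≃ₐ[D] MvPolynomial ι D,
      (∀ f d, f.IsHomogeneous d → (e f).IsHomogeneous d) ∧
      ∀ f d, f.IsHomogeneous d → eval v f = 0 → eval (Pi.single i₀ 1) (e f) = 0 := by
  obtain ⟨b, c, rfl⟩ := Module.exists_basis_smul_eq (Pi.basisFun D ι) i₀ v hv
  refine ⟨linearChange ((Pi.basisFun D ι).toMatrix b) (b.toMatrix (Pi.basisFun D ι))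
    (Module.Basis.toMatrix_mul_toMatrix_flip _ _), fun f d hf ↦ hf.linearChange _ _ _,
    fun f d hf h ↦ ?_⟩
  rw [hf.eval_smul] at h
  rw [eval_linearChange]
  have hc : c ≠ 0 := by
    rintro rfl
    simp at hv
  have hb : ((Pi.basisFun D ι).toMatrix b).mulVec (Pi.single i₀ 1) = b i₀ := by
    ext i
    simp [Module.Basis.toMatrix_apply]
  rw [hb]
  exact (mul_eq_zero.mp h).resolve_left (pow_ne_zero _ hc)

variable {D : Type*} [CommRing D] {m : ℕ}

lemma IsHomogeneous.natDegree_finSuccEquiv_le {f : MvPolynomial (Fin (m + 1)) D} {d : ℕ}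
    (hf : f.IsHomogeneous d) : (finSuccEquiv D m f).natDegree ≤ d := by
  rw [natDegree_finSuccEquiv]
  exact (degreeOf_le_totalDegree f 0).trans hf.totalDegree_le

lemma IsHomogeneous.coeff_finSuccEquiv_eq_zero {f : MvPolynomial (Fin (m + 1)) D} {d : ℕ}
    (hf : f.IsHomogeneous d) (h : eval (Pi.single 0 1) f = 0) :
    (finSuccEquiv D m f).coeff d = 0 := by
  have h1 : (Pi.single 0 1 : Fin (m + 1) → D) = Fin.cons 1 0 := by
    ext i
    refine Fin.cases ?_ (fun i ↦ ?_) i <;> simp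
  rw [h1, eval_eq_eval_mv_eval', Polynomial.eval_eq_sum_range'
    (Nat.lt_succ_of_le (Polynomial.natDegree_map_le.trans hf.natDegree_finSuccEquiv_le)),
    Finset.sum_range_succ, Finset.sum_eq_zero fun i hi ↦ ?_] at h
  · rw [zero_add, one_pow, mul_one, Polynomial.coeff_map, eval_zero] at h
    have h0 := hf.finSuccEquiv_coeff_isHomogeneous d 0 (add_zero d)
    rw [← totalDegree_zero_iff_isHomogeneous] at h0
    rw [totalDegree_eq_zero_iff_eq_C.mp h0]
    rw [constantCoeff_eq] at h
    rw [h, map_zero]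
  · rw [Finset.mem_range] at hi
    rw [Polynomial.coeff_map, (hf.finSuccEquiv_coeff_isHomogeneous i (d - i)
      (by omega)).eval_zero_eq_zero (by omega), zero_mul]

lemma IsHomogeneous.exists_finSuccEquiv_eq_C {f : MvPolynomial (Fin (m + 1)) D}
    (hf : f.IsHomogeneous 1) (h : eval (Pi.single 0 1) f = 0) :
    ∃ l : MvPolynomial (Fin m) D, l.IsHomogeneous 1 ∧ finSuccEquiv D m f = Polynomial.C l := by
  refine ⟨_, hf.finSuccEquiv_coeff_isHomogeneous 0 1 rfl, ?_⟩
  conv_lhs => rw [Polynomial.eq_X_add_C_of_natDegree_le_one hf.natDegree_finSuccEquiv_le]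
  rw [hf.coeff_finSuccEquiv_eq_zero h, map_zero, zero_mul, zero_add]

lemma IsHomogeneous.exists_finSuccEquiv_eq_C_mul_X_add_C {f : MvPolynomial (Fin (m + 1)) D}
    (hf : f.IsHomogeneous 2) (h : eval (Pi.single 0 1) f = 0) :
    ∃ l r : MvPolynomial (Fin m) D, l.IsHomogeneous 1 ∧ r.IsHomogeneous 2 ∧
      finSuccEquiv D m f = Polynomial.C l * Polynomial.X + Polynomial.C r := by
  refine ⟨_, _, hf.finSuccEquiv_coeff_isHomogeneous 1 1 rfl,
    hf.finSuccEquiv_coeff_isHomogeneous 0 2 rfl, ?_⟩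
  refine Polynomial.eq_X_add_C_of_natDegree_le_one ?_
  have h1 := hf.natDegree_finSuccEquiv_le
  by_contra! h2
  have h3 : (finSuccEquiv D m f).natDegree = 2 := by omega
  have h4 := hf.coeff_finSuccEquiv_eq_zero h
  rw [← h3, Polynomial.coeff_natDegree, Polynomial.leadingCoeff_eq_zero] at h4
  simp [h4] at h3

end MvPolynomial

namespace MvPolynomial

/-- Two forms of degrees `d₁` and `d₂` over `D` in more than `d₁ + d₂` variables have a nontrivial
common zero. -/
def HasCommonZeros (D : Type*) [CommRing D] : Prop :=
  ∀ (m d₁ d₂ : ℕ) (f₁ f₂ : MvPolynomial (Fin m) D), d₁ ≠ 0 → d₂ ≠ 0 → f₁.IsHomogeneous d₁ →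
    f₂.IsHomogeneous d₂ → d₁ + d₂ < m → ∃ v, v ≠ 0 ∧ eval v f₁ = 0 ∧ eval v f₂ = 0

lemma hasCommonZeros_of_isAlgClosed (k : Type*) [Field k] [IsAlgClosed k] : HasCommonZeros k := by
  intro m d₁ d₂ f₁ f₂ h₁ h₂ hf₁ hf₂ hlt
  obtain ⟨v, hv, h⟩ := exists_ne_zero_forall_eval_eq_zero ![f₁, f₂] ![d₁, d₂]
    (by simp [Fin.forall_fin_two, h₁, h₂]) (by simp [Fin.forall_fin_two, hf₁, hf₂])
    (by simp only [Nat.card_eq_fintype_card, Fintype.card_fin]; omega)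
  exact ⟨v, hv, h 0, h 1⟩

lemma hasCommonZeros_polynomial (k : Type*) [Field k] [IsAlgClosed k] :
    HasCommonZeros (Polynomial k) := by
  intro m d₁ d₂ f₁ f₂ h₁ h₂ hf₁ hf₂ hlt
  obtain ⟨v, hv, h⟩ := exists_ne_zero_forall_eval_eq_zero_polynomial ![f₁, f₂] ![d₁, d₂]
    (by simp [Fin.forall_fin_two, h₁, h₂]) (by simp [Fin.forall_fin_two, hf₁, hf₂])
    (by simpa [finsum_eq_sum_of_fintype] using hlt)
  exact ⟨v, hv, h 0, h 1⟩

/-- A nontrivial common zero of two forms can be moved to the first basis vector. -/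
lemma HasCommonZeros.exists_algEquiv {D : Type*} [CommRing D] [IsDomain D]
    [IsPrincipalIdealRing D] (hD : HasCommonZeros D) {m d₁ d₂ : ℕ}
    {f₁ f₂ : MvPolynomial (Fin (m + 1)) D} (h₁ : d₁ ≠ 0) (h₂ : d₂ ≠ 0) (hf₁ : f₁.IsHomogeneous d₁)
    (hf₂ : f₂.IsHomogeneous d₂) (h : d₁ + d₂ < m + 1) :
    ∃ e : MvPolynomial (Fin (m + 1)) D ≃ₐ[D] MvPolynomial (Fin (m + 1)) D,
      ((e f₁).IsHomogeneous d₁ ∧ eval (Pi.single 0 1) (e f₁) = 0) ∧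
      ((e f₂).IsHomogeneous d₂ ∧ eval (Pi.single 0 1) (e f₂) = 0) := by
  obtain ⟨v, hv, hv₁, hv₂⟩ := hD _ _ _ f₁ f₂ h₁ h₂ hf₁ hf₂ h
  obtain ⟨e, he, he'⟩ := exists_algEquiv_eval_single_eq_zero 0 v hv
  exact ⟨e, ⟨he _ _ hf₁, he' _ _ hf₁ hv₁⟩, ⟨he _ _ hf₂, he' _ _ hf₂ hv₂⟩⟩

/-- Interchange of the variables in `k[x₁, …, xₘ][t]`. -/
noncomputable def polynomialEquiv (k σ : Type*) [CommRing k] :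
    Polynomial (MvPolynomial σ k) ≃ₐ[k] MvPolynomial σ (Polynomial k) :=
  (optionEquivLeft k σ).symm.trans (optionEquivRight k σ)

lemma polynomialEquiv_X (k σ : Type*) [CommRing k] :
    polynomialEquiv k σ Polynomial.X = C Polynomial.X := by
  rw [polynomialEquiv, AlgEquiv.trans_apply, ← optionEquivLeft_X_none, AlgEquiv.symm_apply_apply,
    optionEquivRight_X_none]

lemma polynomialEquiv_C (k σ : Type*) [CommRing k] (p : MvPolynomial σ k) :
    polynomialEquiv k σ (Polynomial.C p) = map Polynomial.C p := by
  have h : ((polynomialEquiv k σ : Polynomial (MvPolynomial σ k) →+* _).comp Polynomial.C) =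
      map Polynomial.C := by
    ext i : 2
    · simpa using (polynomialEquiv k σ).commutes _
    · simp only [RingHom.comp_apply, RingHom.coe_coe, map_X]
      rw [polynomialEquiv, AlgEquiv.trans_apply, ← optionEquivLeft_X_some,
        AlgEquiv.symm_apply_apply, optionEquivRight_X_some]
  exact DFunLike.congr_fun h p

end MvPolynomial

namespace MotivicMeasure

universe w

variable {k : Type u} [Field k] {R : Type w} [CommRing R] (μ : MotivicMeasure k R)

variable {D : Type u} [CommRing D] [Algebra k D] [Algebra.FiniteType k D]

instance {m : ℕ} : Algebra.FiniteType k (MvPolynomial (Fin m) D) :=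
  Algebra.FiniteType.trans (S := D) inferInstance inferInstance

variable [IsDomain D] [IsPrincipalIdealRing D]

lemma alg_quotient_linear_linear (hL : μ.lef = 0) (hD : HasCommonZeros D) {m : ℕ} (hm : 2 < m)
    {l₁ l₂ : MvPolynomial (Fin m) D} (hl₁ : l₁.IsHomogeneous 1) (hl₂ : l₂.IsHomogeneous 1) :
    μ.alg (MvPolynomial (Fin m) D ⧸ Ideal.span {l₁, l₂}) = 0 := by
  obtain ⟨m, rfl⟩ := Nat.exists_eq_add_one_of_ne_zero (by omega : m ≠ 0)
  obtain ⟨e, ⟨he₁, hv₁⟩, ⟨he₂, hv₂⟩⟩ :=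
    hD.exists_algEquiv one_ne_zero one_ne_zero hl₁ hl₂ (by omega)
  obtain ⟨a₁, -, ha₁⟩ := he₁.exists_finSuccEquiv_eq_C hv₁
  obtain ⟨a₂, -, ha₂⟩ := he₂.exists_finSuccEquiv_eq_C hv₂
  rw [μ.alg_quotient_congr ((e.trans (finSuccEquiv D m)).restrictScalars k) _
    ((Ideal.span {a₁, a₂}).map Polynomial.C), alg_quotient_map_C, hL, zero_mul]
  rw [Ideal.map_span, Ideal.map_span, Set.image_pair, Set.image_pair, ← ha₁, ← ha₂]
  rfl

lemma alg_quotient_linear_quadratic (hL : μ.lef = 0) (hD : HasCommonZeros D) {m : ℕ} (hm : 3 < m)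
    {l q : MvPolynomial (Fin m) D} (hl : l.IsHomogeneous 1) (hq : q.IsHomogeneous 2) :
    μ.alg (MvPolynomial (Fin m) D ⧸ Ideal.span {l, q}) = 0 := by
  obtain ⟨m, rfl⟩ := Nat.exists_eq_add_one_of_ne_zero (by omega : m ≠ 0)
  obtain ⟨e, ⟨he₁, hv₁⟩, ⟨he₂, hv₂⟩⟩ :=
    hD.exists_algEquiv one_ne_zero two_ne_zero hl hq (by omega)
  obtain ⟨a, ha, ha'⟩ := he₁.exists_finSuccEquiv_eq_C hv₁
  obtain ⟨b, r, hb, -, hb'⟩ := he₂.exists_finSuccEquiv_eq_C_mul_X_add_C hv₂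
  rw [μ.alg_quotient_congr ((e.trans (finSuccEquiv D m)).restrictScalars k) _
    ((Ideal.span {a}).map Polynomial.C ⊔
      Ideal.span {Polynomial.C b * Polynomial.X + Polynomial.C r}), alg_quotient_linear _ hL,
    ← Ideal.span_union, Set.singleton_union,
    alg_quotient_linear_linear μ hL hD (by omega) ha hb, sub_zero,
    alg_quotient_of_eq μ (J := Ideal.span {a, 0}) (by simp),
    alg_quotient_linear_linear μ hL hD (by omega) ha (isHomogeneous_zero _ _ _)]
  rw [Ideal.map_span, Ideal.map_span, Set.image_pair, Set.image_singleton, ← Ideal.span_union,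
    Set.singleton_union, ← ha', ← hb']
  rfl

variable [IsAlgClosed k]

lemma alg_quotient_quadratic_quadratic (hL : μ.lef = 0) {m : ℕ} (hm : 4 < m)
    {q₁ q₂ : MvPolynomial (Fin m) k} (hq₁ : q₁.IsHomogeneous 2) (hq₂ : q₂.IsHomogeneous 2) :
    μ.alg (MvPolynomial (Fin m) k ⧸ Ideal.span {q₁, q₂}) = 0 := by
  obtain ⟨m, rfl⟩ := Nat.exists_eq_add_one_of_ne_zero (by omega : m ≠ 0)
  have hk := hasCommonZeros_of_isAlgClosed k
  obtain ⟨e, ⟨he₁, hv₁⟩, ⟨he₂, hv₂⟩⟩ :=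
    hk.exists_algEquiv two_ne_zero two_ne_zero hq₁ hq₂ (by omega)
  obtain ⟨l₁, r₁, hl₁, hr₁, h₁⟩ := he₁.exists_finSuccEquiv_eq_C_mul_X_add_C hv₁
  obtain ⟨l₂, r₂, hl₂, hr₂, h₂⟩ := he₂.exists_finSuccEquiv_eq_C_mul_X_add_C hv₂
  have hW := μ.alg_quotient_linear_quadratic hL (hasCommonZeros_polynomial k) (m := m) (by omega)
    (l := map Polynomial.C l₂ - map Polynomial.C l₁ * C Polynomial.X)
    (q := map Polynomial.C r₂ - map Polynomial.C r₁ * C Polynomial.X)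
    ((hl₂.map _).sub ((hl₁.map _).mul (isHomogeneous_C _ _)))
    ((hr₂.map _).sub ((hr₁.map _).mul (isHomogeneous_C _ _)))
  rw [μ.alg_quotient_congr (e.trans (finSuccEquiv k m)) _
    (Ideal.span {Polynomial.C l₁ * Polynomial.X + Polynomial.C r₁,
      Polynomial.C l₂ * Polynomial.X + Polynomial.C r₂}), alg_quotient_linear_pair _ hL,
    alg_quotient_linear_quadratic μ hL hk (by omega) hl₁ hr₁,
    alg_quotient_linear_linear μ hL hk (by omega) hl₁ hl₂,
    μ.alg_quotient_congr (polynomialEquiv k (Fin m)) _ _ ?_, hW]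
  · simp
  · rw [Ideal.map_span, Set.image_pair]
    simp [polynomialEquiv_C, polynomialEquiv_X]
  · rw [Ideal.map_span, Set.image_pair, ← h₁, ← h₂]
    rfl

/-- The affine cone over the union of two quadrics. -/
lemma alg_quotient_mul_quadratic (hL : μ.lef = 0) {m : ℕ} (hm : 4 < m)
    {q₁ q₂ : MvPolynomial (Fin m) k} (hq₁ : q₁.IsHomogeneous 2) (hq₂ : q₂.IsHomogeneous 2) :
    μ.alg (MvPolynomial (Fin m) k ⧸ Ideal.span {q₁ * q₂}) = 0 := by
  have hk := hasCommonZeros_of_isAlgClosed k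
  have hq (q : MvPolynomial (Fin m) k) (hq : q.IsHomogeneous 2) :
      μ.alg (MvPolynomial (Fin m) k ⧸ Ideal.span {q}) = 0 := by
    rw [alg_quotient_of_eq μ (J := Ideal.span {0, q}) (by simp)]
    exact alg_quotient_linear_quadratic μ hL hk (by omega) (isHomogeneous_zero _ _ _) hq
  have h := μ.alg_quotient_sub_eq (Ideal.span {q₁ * q₂}) (Ideal.span {q₂}) (AlgHom.id k _) q₁
    (fun p hp ↦ Ideal.span_singleton_le_span_singleton.mpr (Dvd.intro_left _ rfl) hp)
    (fun q ↦ ⟨0, q, by simp⟩) (fun p hp ↦ ⟨1, by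
      rw [AlgHom.id_apply, Ideal.mem_span_singleton] at hp
      rw [Ideal.mem_span_singleton, pow_one]
      exact mul_dvd_mul_left q₁ hp⟩)
  have h' : Ideal.span {q₁ * q₂} ⊔ Ideal.span {q₁} = Ideal.span {q₁} :=
    sup_eq_right.mpr (Ideal.span_singleton_le_span_singleton.mpr (Dvd.intro _ rfl))
  rw [AlgHom.id_apply, alg_quotient_of_eq μ h', hq _ hq₁, hq _ hq₂, ← Ideal.span_union,
    Set.singleton_union, alg_quotient_quadratic_quadratic μ hL hm hq₂ hq₁, sub_zero, sub_zero] at h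
  exact h

end MotivicMeasure

section

variable {k : Type u} [Field k] {R : Type v} [CommRing R]

/-- The composition of a motivic measure with a ring homomorphism. -/
noncomputable def MotivicMeasure.map {S : Type*} [CommRing S] (μ : MotivicMeasure k R)
    (g : R →+* S) : MotivicMeasure k S where
  cl X sX := g (μ.cl X sX)
  cl_point := by rw [μ.cl_point, map_one]
  cl_iso sX sY e h₁ h₂ h₃ h := by rw [μ.cl_iso sX sY e h₁ h₂ h₃ h]
  cl_scissor sX i h₁ h₂ h₃ h₄ U hU := by rw [μ.cl_scissor sX i h₁ h₂ h₃ h₄ U hU, map_add]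
  cl_prod sX sY h₁ h₂ h₃ h₄ h₅ h₆ := by rw [μ.cl_prod sX sY h₁ h₂ h₃ h₄ h₅ h₆, map_mul]

lemma MvPolynomial.aeval_mul_of_isHomogeneous {σ K B : Type*} [CommRing K] [CommRing B]
    [Algebra K B] {p : MvPolynomial σ K} {d : ℕ} (hp : p.IsHomogeneous d) (r : B) (t : σ → B) :
    aeval (fun i ↦ r * t i) p = r ^ d * aeval t p := by
  rw [aeval_def, aeval_def, eval₂_eq, eval₂_eq, Finset.mul_sum]
  refine Finset.sum_congr rfl fun m hm ↦ ?_
  have hd : ∑ i ∈ m.support, m i = d := by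
    have := hp (mem_support_iff.mp hm)
    rwa [Finsupp.weight_apply, Finsupp.sum, Finset.sum_congr rfl fun i _ ↦ by
      rw [Pi.one_apply, smul_eq_mul, mul_one]] at this
  simp_rw [mul_pow, Finset.prod_mul_distrib, Finset.prod_pow_eq_pow_sum, hd]
  ring

namespace MotivicMeasure

variable (μ : MotivicMeasure k R)

lemma alg_quotient_map_C_sup_X {B : Type u} [CommRing B] [Algebra k B] [Algebra.FiniteType k B]
    (J : Ideal B) :
    μ.alg (Polynomial B ⧸ J.map Polynomial.C ⊔ Ideal.span {Polynomial.X}) = μ.alg (B ⧸ J) := by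
  have hs : Function.Surjective ((Ideal.Quotient.mkₐ k J).comp
      ((Polynomial.aeval (R := B) (0 : B)).restrictScalars k)) := by
    refine (Ideal.Quotient.mkₐ_surjective k J).comp fun b ↦ ⟨Polynomial.C b, ?_⟩
    simp
  rw [← μ.alg_congr (Ideal.quotientKerAlgEquivOfSurjective hs)]
  refine μ.alg_quotient_of_eq (le_antisymm ?_ fun p hp ↦ ?_)
  · rw [sup_le_iff, Ideal.map_le_iff_le_comap, Ideal.span_singleton_le_iff_mem]
    refine ⟨fun b hb ↦ ?_, ?_⟩
    · simpa [RingHom.mem_ker, Ideal.Quotient.eq_zero_iff_mem] using hb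
    · simp [RingHom.mem_ker]
  · replace hp : p.eval 0 ∈ J := by
      simpa [RingHom.mem_ker, Ideal.Quotient.eq_zero_iff_mem] using hp
    rw [← Polynomial.divX_mul_X_add p]
    refine Ideal.add_mem _ (Ideal.mem_sup_right ?_) (Ideal.mem_sup_left ?_)
    · exact Ideal.mul_mem_left _ _ (Ideal.mem_span_singleton_self _)
    · rw [Polynomial.coeff_zero_eq_eval_zero]
      exact Ideal.mem_map_of_mem _ hp

/-- The part of a cone where the coordinate `X j` does not vanish is the product of the
corresponding affine chart of the projectivization with the punctured line. -/
lemma alg_quotient_sub_eq_lef_sub_one_mul {σ : Type} [Finite σ] {B : Type u} [CommRing B]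
    [Algebra k B] [Algebra.FiniteType k B] (j : σ) (t : σ → B) (htj : t j = 1)
    (ht : Function.Surjective (aeval t : MvPolynomial σ k →ₐ[k] B))
    (v : B →ₐ[k] Localization.Away (X j : MvPolynomial σ k))
    (hv : ∀ i, algebraMap _ _ (X j : MvPolynomial σ k) * v (t i) =
      algebraMap _ _ (X i : MvPolynomial σ k))
    (S : Set (MvPolynomial σ k)) (hS : ∀ s ∈ S, ∃ d, s.IsHomogeneous d) :
    μ.alg (MvPolynomial σ k ⧸ Ideal.span S) -
        μ.alg (MvPolynomial σ k ⧸ Ideal.span S ⊔ Ideal.span {X j}) =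
      (μ.lef - 1) * μ.alg (B ⧸ Ideal.span ((aeval t : MvPolynomial σ k →ₐ[k] B) '' S)) := by
  set J := Ideal.span ((aeval t : MvPolynomial σ k →ₐ[k] B) '' S) with hJ
  let φ : MvPolynomial σ k →ₐ[k] Polynomial B :=
    aeval fun i ↦ Polynomial.X * Polynomial.C (t i)
  have hφj : φ (X j) = Polynomial.X := by simp [φ, htj]
  have hφ (s : MvPolynomial σ k) (d : ℕ) (hs : s.IsHomogeneous d) :
      φ s = Polynomial.X ^ d * Polynomial.C (aeval t s) := by
    rw [aeval_mul_of_isHomogeneous hs]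
    congr 1
    exact (map_aeval t (Polynomial.C) s).symm ▸ rfl
  let ψ : Polynomial B →ₐ[k] Localization.Away (X j : MvPolynomial σ k) :=
    { Polynomial.eval₂RingHom (v : B →+* _) (algebraMap _ _ (X j : MvPolynomial σ k)) with
      commutes' := fun r ↦ by simp [IsScalarTower.algebraMap_apply k B (Polynomial B)] }
  have hψ : ψ.comp φ = IsScalarTower.toAlgHom k _ _ := by
    ext i
    have h : φ (X i) = Polynomial.X * Polynomial.C (t i) := by simp [φ]
    suffices v (t i) * algebraMap _ _ (X j : MvPolynomial σ k) =
        algebraMap _ _ (X i : MvPolynomial σ k) by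
      simpa [ψ, h]
    rw [mul_comm, hv]
  have hu : IsUnit
      (algebraMap (MvPolynomial σ k) (Localization.Away (X j : MvPolynomial σ k)) (X j)) :=
    IsLocalization.Away.algebraMap_isUnit _
  rw [μ.alg_quotient_sub_eq (Ideal.span S) (J.map Polynomial.C) φ (X j), hφj, alg_quotient_map_C,
    alg_quotient_map_C_sup_X]
  · ring
  · intro p hp
    have : Ideal.span S ≤ (J.map Polynomial.C).comap φ := by
      rw [Ideal.span_le]
      intro s hs
      obtain ⟨d, hd⟩ := hS s hs
      rw [SetLike.mem_coe, Ideal.mem_comap, hφ s d hd]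
      exact Ideal.mul_mem_left _ _ (Ideal.mem_map_of_mem _ (Ideal.subset_span ⟨s, hs, rfl⟩))
    exact this hp
  · intro q
    suffices q ∈
      rangeUpToPow (φ : MvPolynomial σ k →+* Polynomial B) (X j) (J.map Polynomial.C) from this
    have hX : Polynomial.X ∈
        rangeUpToPow (φ : MvPolynomial σ k →+* Polynomial B) (X j) (J.map Polynomial.C) := by
      rw [← hφj]
      exact map_mem_rangeUpToPow (φ : MvPolynomial σ k →+* Polynomial B) _ _ _
    have hC (b : B) : Polynomial.C b ∈
        rangeUpToPow (φ : MvPolynomial σ k →+* Polynomial B) (X j) (J.map Polynomial.C) := by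
      obtain ⟨p, rfl⟩ := ht b
      induction p using MvPolynomial.induction_on with
      | C a =>
        convert map_mem_rangeUpToPow (φ : MvPolynomial σ k →+* Polynomial B) _ _ (C a)
        simp [φ, ← MvPolynomial.algebraMap_eq]
      | add p q hp hq =>
        rw [map_add, map_add]
        exact add_mem hp hq
      | mul_X p i hp =>
        rw [map_mul, map_mul]
        refine mul_mem hp ⟨1, X i, ?_⟩
        simp [φ, htj]
    induction q using Polynomial.induction_on' with
    | add p q hp hq => exact add_mem hp hq
    | monomial n a =>
      rw [← Polynomial.C_mul_X_pow_eq_monomial]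
      exact mul_mem (hC a) (pow_mem hX n)
  · intro p hp
    have hle : J.map Polynomial.C ≤ ((Ideal.span S).map
        (algebraMap _ (Localization.Away (X j : MvPolynomial σ k)))).comap ψ := by
      rw [Ideal.map_le_iff_le_comap, hJ, Ideal.span_le]
      rintro _ ⟨s, hs, rfl⟩
      obtain ⟨d, hd⟩ := hS s hs
      rw [SetLike.mem_coe, Ideal.mem_comap, Ideal.mem_comap,
        ← Ideal.unit_mul_mem_iff_mem _ (hu.pow d)]
      have : ψ (φ s) = algebraMap _ _ s := DFunLike.congr_fun hψ s
      rw [hφ s d hd, map_mul, map_pow] at this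
      have hX : ψ Polynomial.X = algebraMap _ _ (X j : MvPolynomial σ k) := by simp [ψ]
      rw [hX] at this
      rw [this]
      exact Ideal.mem_map_of_mem _ (Ideal.subset_span hs)
    have h := hle hp
    rw [Ideal.mem_comap] at h
    have h' : ψ (φ p) = algebraMap _ _ p := DFunLike.congr_fun hψ p
    rw [h', IsLocalization.algebraMap_mem_map_algebraMap_iff (Submonoid.powers (X j))] at h
    obtain ⟨_, ⟨n, rfl⟩, hn⟩ := h
    exact ⟨n, hn⟩

end MotivicMeasure

end

namespace ProjSpace

variable (k : Type u) [Field k] (n : ℕ)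

/-- The coordinate ring of the chart of projective space where `X j` does not vanish. -/
abbrev Chart (j : Fin (n + 1)) : Type u :=
  HomogeneousLocalization.Away (homogeneousSubmodule (Fin (n + 1)) k) (X j)

noncomputable instance (j : Fin (n + 1)) : Algebra k (Chart k n j) :=
  ((HomogeneousLocalization.fromZeroRingHom (homogeneousSubmodule (Fin (n + 1)) k)
    (Submonoid.powers (X j))).comp
      (algebraMap k (homogeneousSubmodule (Fin (n + 1)) k 0))).toAlgebra

variable {k n} (j : Fin (n + 1))

lemma X_mem_homogeneousSubmodule (i : Fin (n + 1)) :
    (X i : MvPolynomial (Fin (n + 1)) k) ∈ homogeneousSubmodule (Fin (n + 1)) k 1 :=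
  isHomogeneous_X k i

/-- The inclusion of the coordinate ring of a chart in the coordinate ring of its cone. -/
noncomputable def chartVal :
    Chart k n j →ₐ[k] Localization.Away (X j : MvPolynomial (Fin (n + 1)) k) :=
  { algebraMap (Chart k n j) (Localization.Away (X j : MvPolynomial (Fin (n + 1)) k)) with
    commutes' := fun r ↦ by
      rfl }

lemma chartVal_injective : Function.Injective (chartVal (k := k) j) :=
  HomogeneousLocalization.val_injective _

/-- The coordinate `X i / X j` on the chart where `X j` does not vanish. -/
noncomputable def chartCoord (i : Fin (n + 1)) : Chart k n j :=
  HomogeneousLocalization.Away.mk _ (X_mem_homogeneousSubmodule j) 1 (X i)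
    (X_mem_homogeneousSubmodule i)

lemma pow_mul_chartVal_mk (d : ℕ) (a : MvPolynomial (Fin (n + 1)) k)
    (ha : a ∈ homogeneousSubmodule (Fin (n + 1)) k (d • 1)) :
    algebraMap _ _ (X j : MvPolynomial (Fin (n + 1)) k) ^ d * chartVal j
      (HomogeneousLocalization.Away.mk _ (X_mem_homogeneousSubmodule j) d a ha) =
      algebraMap _ _ a := by
  rw [← map_pow]
  have : chartVal j (HomogeneousLocalization.Away.mk _ (X_mem_homogeneousSubmodule j) d a ha) =
    IsLocalization.mk' (Localization.Away (X j : MvPolynomial (Fin (n + 1)) k)) a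
      (⟨X j ^ d, d, rfl⟩ : Submonoid.powers (X j : MvPolynomial (Fin (n + 1)) k)) :=
    congrFun (congrFun Localization.mk_eq_mk' _) _
  rw [this, mul_comm]
  exact IsLocalization.mk'_spec _ _ _

lemma mul_chartVal_chartCoord (i : Fin (n + 1)) :
    algebraMap _ _ (X j : MvPolynomial (Fin (n + 1)) k) *
        chartVal (k := k) j (chartCoord j i) =
      algebraMap _ _ (X i : MvPolynomial (Fin (n + 1)) k) := by
  rw [← pow_mul_chartVal_mk j 1 (X i) (X_mem_homogeneousSubmodule i), pow_one]
  rfl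

lemma chartCoord_self : (chartCoord j j : Chart k n j) = 1 := by
  refine chartVal_injective j ?_
  rw [map_one, ← (IsLocalization.Away.algebraMap_isUnit
    (X j : MvPolynomial (Fin (n + 1)) k)).mul_right_inj, mul_chartVal_chartCoord, mul_one]

lemma aeval_chartCoord (d : ℕ) (a : MvPolynomial (Fin (n + 1)) k)
    (ha : a ∈ homogeneousSubmodule (Fin (n + 1)) k (d • 1)) :
    aeval (chartCoord j) a =
      HomogeneousLocalization.Away.mk _ (X_mem_homogeneousSubmodule j) d a ha := by
  refine chartVal_injective j ?_
  have h : a.IsHomogeneous d := by simpa using ha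
  rw [← ((IsLocalization.Away.algebraMap_isUnit
    (X j : MvPolynomial (Fin (n + 1)) k)).pow d).mul_right_inj, pow_mul_chartVal_mk,
    comp_aeval_apply, ← aeval_mul_of_isHomogeneous h]
  simp_rw [mul_chartVal_chartCoord]
  exact (comp_aeval_apply (f := X) (IsScalarTower.toAlgHom k (MvPolynomial (Fin (n + 1)) k)
    (Localization.Away (X j : MvPolynomial (Fin (n + 1)) k))) a).symm.trans
      (congrArg _ (aeval_X_left_apply a))

lemma aeval_chartCoord_surjective :
    Function.Surjective
      (aeval (chartCoord j) : MvPolynomial (Fin (n + 1)) k →ₐ[k] Chart k n j) := by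
  intro b
  obtain ⟨d, a, ha, rfl⟩ := HomogeneousLocalization.Away.mk_surjective _
    (X_mem_homogeneousSubmodule j) b
  exact ⟨a, aeval_chartCoord j d a ha⟩

instance : Algebra.FiniteType k (Chart k n j) :=
  Algebra.FiniteType.of_surjective _ (aeval_chartCoord_surjective j)

/-- The chart of projective space where `X j` does not vanish. -/
noncomputable def chart_s9 : Spec (CommRingCat.of (Chart k n j)) ⟶ ProjSpace k n :=
  Proj.awayι (homogeneousSubmodule (Fin (n + 1)) k) (X j) (X_mem_homogeneousSubmodule j) one_pos

instance : IsOpenImmersion (chart_s9 (k := k) j) :=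
  inferInstanceAs (IsOpenImmersion (Proj.awayι (homogeneousSubmodule (Fin (n + 1)) k) (X j) _ _))

lemma chart_toSpec : chart_s9 j ≫ toSpec k n =
    Spec.map (CommRingCat.ofHom (algebraMap k (Chart k n j))) := by
  refine (Proj.awayι_toSpecZero_assoc (homogeneousSubmodule (Fin (n + 1)) k) (X j)
    (X_mem_homogeneousSubmodule j) one_pos _).trans ?_
  rw [← Spec.map_comp]
  rfl

lemma range_chart_s9 : Set.range (chart_s9 (k := k) j).base =
    (ProjectiveSpectrum.zeroLocus (homogeneousSubmodule (Fin (n + 1)) k) {X j})ᶜ := by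
  have := congrArg (fun U : TopologicalSpace.Opens (Proj (homogeneousSubmodule (Fin (n + 1)) k)) ↦
    (U : Set (Proj (homogeneousSubmodule (Fin (n + 1)) k))))
    (Proj.opensRange_awayι (homogeneousSubmodule (Fin (n + 1)) k) (X j)
      (X_mem_homogeneousSubmodule j) one_pos)
  refine this.trans ?_
  exact ProjectiveSpectrum.basicOpen_eq_zeroLocus_compl _ _

lemma chart_preimage_zeroLocus (S : Set (MvPolynomial (Fin (n + 1)) k))
    (hS : ∀ s ∈ S, ∃ d, 0 < d ∧ s.IsHomogeneous d) :
    (chart_s9 (k := k) j).base ⁻¹'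
      (ProjectiveSpectrum.zeroLocus (homogeneousSubmodule (Fin (n + 1)) k) S) =
      PrimeSpectrum.zeroLocus
        ((aeval (chartCoord j) : MvPolynomial (Fin (n + 1)) k →ₐ[k] Chart k n j) '' S) := by
  ext y
  suffices h : ∀ s ∈ S, (s ∈ ((chart_s9 (k := k) j).base y).asHomogeneousIdeal ↔
      aeval (chartCoord j) s ∈ y.asIdeal) by
    refine Iff.trans (forall₂_congr h) ?_
    exact Set.image_subset_iff.symm
  intro s hs
  obtain ⟨d, hd, h⟩ := hS s hs
  have h1 : (y ∈ (chart_s9 (k := k) j) ⁻¹ᵁ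
      Proj.basicOpen (homogeneousSubmodule (Fin (n + 1)) k) s) ↔ _ :=
    SetLike.ext_iff.mp (Proj.awayι_preimage_basicOpen (homogeneousSubmodule (Fin (n + 1)) k)
      (X_mem_homogeneousSubmodule j) one_pos (g := s) h hd) y
  have h2 := aeval_chartCoord j d (s ^ 1) (by simpa using h)
  rw [← not_iff_not, ← pow_one (aeval (chartCoord j) s), ← map_pow, h2]
  exact h1

end ProjSpace

namespace ProjSpace

variable {k : Type u} [Field k] {n : ℕ}

/-- The polynomial `f` together with the first `j` coordinates. -/
def sliceEquations (f : MvPolynomial (Fin (n + 1)) k) (j : ℕ) :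
    Set (MvPolynomial (Fin (n + 1)) k) :=
  insert f (X '' {i | (i : ℕ) < j})

lemma sliceEquations_zero (f : MvPolynomial (Fin (n + 1)) k) : sliceEquations f 0 = {f} := by
  simp [sliceEquations]

lemma sliceEquations_union (f : MvPolynomial (Fin (n + 1)) k) (j : Fin (n + 1)) :
    sliceEquations f j ∪ {X j} = sliceEquations f (j + 1) := by
  have : {i : Fin (n + 1) | (i : ℕ) < (j : ℕ) + 1} =
      insert j {i : Fin (n + 1) | (i : ℕ) < (j : ℕ)} := by
    ext i
    simp only [Set.mem_ofPred_eq, Set.mem_insert_iff, Fin.ext_iff]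
    omega
  rw [sliceEquations, sliceEquations, this, Set.image_insert_eq, Set.union_singleton,
    Set.insert_comm]

lemma exists_isHomogeneous_of_mem_sliceEquations {f : MvPolynomial (Fin (n + 1)) k} {d : ℕ}
    (hd : 0 < d) (hf : f.IsHomogeneous d) (j : ℕ) :
    ∀ s ∈ sliceEquations f j, ∃ e, 0 < e ∧ s.IsHomogeneous e := by
  rintro s (rfl | ⟨i, -, rfl⟩)
  · exact ⟨d, hd, hf⟩
  · exact ⟨1, one_pos, isHomogeneous_X k i⟩

lemma zeroLocus_range_X_eq_empty :
    ProjectiveSpectrum.zeroLocus (homogeneousSubmodule (Fin (n + 1)) k) (Set.range X) = ∅ := by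
  have h := Proj.iSup_basicOpen_eq_top' (homogeneousSubmodule (Fin (n + 1)) k)
    (X : Fin (n + 1) → MvPolynomial (Fin (n + 1)) k) (fun i ↦ ⟨1, isHomogeneous_X k i⟩) (by
      refine top_le_iff.mp fun p _ ↦ ?_
      induction p using MvPolynomial.induction_on with
      | C a =>
        exact Subalgebra.algebraMap_mem _
          (⟨C a, isHomogeneous_C _ a⟩ : homogeneousSubmodule (Fin (n + 1)) k 0)
      | add p q hp hq => exact add_mem (hp trivial) (hq trivial)
      | mul_X p i hp => exact mul_mem (hp trivial) (Algebra.subset_adjoin ⟨i, rfl⟩))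
  refine Set.eq_empty_of_forall_notMem fun x hx ↦ ?_
  have hx' : x ∈ ⨆ i, Proj.basicOpen (homogeneousSubmodule (Fin (n + 1)) k) (X i) := by
    rw [h]
    trivial
  obtain ⟨i, hi⟩ := TopologicalSpace.Opens.mem_iSup.mp hx'
  exact hi (hx ⟨i, rfl⟩)

instance : Algebra.FiniteType (homogeneousSubmodule (Fin (n + 1)) k 0)
    (MvPolynomial (Fin (n + 1)) k) :=
  have : IsScalarTower k (homogeneousSubmodule (Fin (n + 1)) k 0) (MvPolynomial (Fin (n + 1)) k) :=
    IsScalarTower.of_algebraMap_eq (R := k) (S := homogeneousSubmodule (Fin (n + 1)) k 0)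
      (A := MvPolynomial (Fin (n + 1)) k) fun _ ↦ rfl
  .of_restrictScalars_finiteType k _ _

lemma finiteType_homogeneousSubmodule_zero :
    Algebra.FiniteType k (homogeneousSubmodule (Fin (n + 1)) k 0) := by
  refine Algebra.FiniteType.of_surjective (Algebra.ofId k _) fun ⟨p, hp⟩ ↦ ?_
  refine ⟨coeff 0 p, Subtype.ext ?_⟩
  exact ((totalDegree_eq_zero_iff_eq_C).mp (Nat.le_zero.mp hp.totalDegree_le)).symm

instance : LocallyOfFiniteType (toSpec k n) := by
  have := finiteType_homogeneousSubmodule_zero (k := k) (n := n)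
  have := MotivicMeasure.locallyOfFiniteType_algebraMap (k := k)
    (homogeneousSubmodule (Fin (n + 1)) k 0)
  exact inferInstanceAs (LocallyOfFiniteType
    (Proj.toSpecZero (homogeneousSubmodule (Fin (n + 1)) k) ≫ _))

instance : QuasiCompact (toSpec k n) :=
  inferInstanceAs (QuasiCompact (Proj.toSpecZero (homogeneousSubmodule (Fin (n + 1)) k) ≫ _))

instance : IsSeparated (toSpec k n) :=
  inferInstanceAs (IsSeparated (Proj.toSpecZero (homogeneousSubmodule (Fin (n + 1)) k) ≫ _))

instance (j : Fin (n + 1)) : QuasiCompact (chart_s9 (k := k) j) := by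
  have : QuasiCompact (chart_s9 (k := k) j ≫ toSpec k n) := by
    rw [chart_toSpec]
    infer_instance
  exact .of_comp _ (toSpec k n)

end ProjSpace

namespace MotivicMeasure

universe w

variable {k : Type u} [Field k] {R : Type w} [CommRing R] (μ : MotivicMeasure k R)

open ProjSpace

lemma alg_quotient_idealOfVars {n : ℕ} :
    μ.alg (MvPolynomial (Fin (n + 1)) k ⧸ idealOfVars (Fin (n + 1)) k) = 1 := by
  have hs : Function.Surjective (aeval (0 : Fin (n + 1) → k)) :=
    fun a ↦ ⟨C a, by simp⟩
  rw [← μ.alg_self, ← μ.alg_congr (Ideal.quotientKerAlgEquivOfSurjective hs)]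
  refine μ.alg_quotient_of_eq ?_
  ext p
  rw [← pow_one (idealOfVars _ _), mem_pow_idealOfVars_iff', RingHom.mem_ker, aeval_zero,
    constantCoeff_eq]
  simp [Finsupp.degree_eq_zero_iff]

/-- A closed subscheme of projective space decomposes into its intersections with a standard
chart and with the complementary hyperplane. -/
lemma exists_cl_eq_alg_chart_add_cl {n : ℕ} (j : Fin (n + 1))
    (S : Set (MvPolynomial (Fin (n + 1)) k)) (hS : ∀ s ∈ S, ∃ d, 0 < d ∧ s.IsHomogeneous d)
    {Z : Scheme.{u}} (i : Z ⟶ ProjSpace k n) [IsClosedImmersion i]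
    (hi : Set.range i.base =
      ProjectiveSpectrum.zeroLocus (homogeneousSubmodule (Fin (n + 1)) k) S) :
    ∃ (Z' : Scheme.{u}) (i' : Z' ⟶ ProjSpace k n), IsClosedImmersion i' ∧
      Set.range i'.base =
        ProjectiveSpectrum.zeroLocus (homogeneousSubmodule (Fin (n + 1)) k) (S ∪ {X j}) ∧
      μ.cl Z (i ≫ toSpec k n) = μ.alg (Chart k n j ⧸ Ideal.span
        ((aeval (chartCoord j) : MvPolynomial (Fin (n + 1)) k →ₐ[k] Chart k n j) '' S)) +
          μ.cl Z' (i' ≫ toSpec k n) := by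
  let H : Set (ProjSpace k n) :=
    ProjectiveSpectrum.zeroLocus (homogeneousSubmodule (Fin (n + 1)) k) {X j}
  have hH : IsClosed H := ProjectiveSpectrum.isClosed_zeroLocus _ _
  let W : TopologicalSpace.Closeds Z := ⟨i.base ⁻¹' H, hH.preimage i.continuous⟩
  let l := (Scheme.IdealSheafData.vanishingIdeal W).subschemeι
  have hl : Set.range l.base = i.base ⁻¹' H := by
    refine (Scheme.IdealSheafData.range_subschemeι _).trans ?_
    rw [Scheme.IdealSheafData.coe_support_vanishingIdeal]
    rfl
  refine ⟨_, l ≫ i, inferInstance, ?_, ?_⟩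
  · rw [ProjectiveSpectrum.zeroLocus_union, ← hi, Scheme.Hom.comp_base, TopCat.coe_comp,
      Set.range_comp, hl, Set.image_preimage_eq_inter_range, Set.inter_comm]
    rfl
  · have hfst : Set.range (pullback.fst i (chart_s9 j)).base = (Set.range l.base)ᶜ := by
      rw [hl, ← Set.preimage_compl]
      refine (Scheme.Pullback.range_fst i (chart_s9 j)).trans ?_
      exact congrArg _ (range_chart_s9 j)
    rw [μ.cl_eq_add_s9 _ (pullback.fst i (chart_s9 j)) l hfst, Category.assoc]
    congr 1
    refine μ.cl_eq_alg_quotient _ (pullback.snd i (chart_s9 j)) ?_ _ ?_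
    · rw [← chart_toSpec, pullback.condition_assoc]
    · rw [PrimeSpectrum.zeroLocus_span, ← chart_preimage_zeroLocus j S hS, ← hi]
      exact Scheme.Pullback.range_snd i (chart_s9 j)

/-- The relation between the class of a projective hypersurface and the class of the affine cone
over it. -/
lemma lef_sub_one_mul_cl_eq {n : ℕ} {f : MvPolynomial (Fin (n + 1)) k} {d : ℕ} (hd : 0 < d)
    (hf : f.IsHomogeneous d) (m : ℕ) : ∀ j, m + j = n + 1 → ∀ {Z : Scheme.{u}}
    (i : Z ⟶ ProjSpace k n) [IsClosedImmersion i], Set.range i.base =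
      ProjectiveSpectrum.zeroLocus (homogeneousSubmodule (Fin (n + 1)) k) (sliceEquations f j) →
    (μ.lef - 1) * μ.cl Z (i ≫ toSpec k n) =
      μ.alg (MvPolynomial (Fin (n + 1)) k ⧸ Ideal.span (sliceEquations f j)) - 1 := by
  induction m with
  | zero =>
    intro j hj Z i _ hi
    have hX : Set.range (X : Fin (n + 1) → MvPolynomial (Fin (n + 1)) k) ⊆ sliceEquations f j := by
      rintro _ ⟨i, rfl⟩
      exact Or.inr ⟨i, by simp; omega, rfl⟩
    have : IsEmpty Z := by
      refine Set.range_eq_empty_iff.mp (hi.trans (Set.subset_empty_iff.mp ?_))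
      exact (ProjectiveSpectrum.zeroLocus_anti_mono _ hX).trans zeroLocus_range_X_eq_empty.subset
    rw [cl_empty, mul_zero, eq_comm, sub_eq_zero, ← μ.alg_quotient_idealOfVars (n := n)]
    refine μ.alg_quotient_of_eq (le_antisymm (Ideal.span_le.mpr ?_) (Ideal.span_mono hX))
    rintro _ (rfl | ⟨i, -, rfl⟩)
    · rw [SetLike.mem_coe, ← pow_one (idealOfVars _ _), mem_pow_idealOfVars_iff']
      intro x hx
      refine hf.coeff_eq_zero ?_
      omega
    · exact Ideal.subset_span ⟨i, rfl⟩
  | succ m ih =>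
    intro j hj Z i _ hi
    obtain ⟨j, rfl⟩ : ∃ j' : Fin (n + 1), (j' : ℕ) = j := ⟨⟨j, by omega⟩, rfl⟩
    have hS := exists_isHomogeneous_of_mem_sliceEquations hd hf j
    obtain ⟨Z', i', _, hi', h⟩ := μ.exists_cl_eq_alg_chart_add_cl j _ hS i hi
    rw [sliceEquations_union] at hi'
    have h1 := ih (j + 1) (by omega) i' hi'
    have h2 := μ.alg_quotient_sub_eq_lef_sub_one_mul j (chartCoord j) (chartCoord_self j)
      (aeval_chartCoord_surjective j) (chartVal j) (mul_chartVal_chartCoord j) (sliceEquations f j)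
      fun s hs ↦ (hS s hs).imp fun _ h ↦ h.2
    rw [← Ideal.span_union, sliceEquations_union] at h2
    rw [h, mul_add, ← h2, h1]
    ring

end MotivicMeasure

/-- Let `k` be an algebraically closed field of characteristic zero and
let `X = Q₁ ∪ Q₂ ⊂ ℙⁿ_k` be the union of two quadric hypersurfaces `Q₁ = V(q₁)` and
`Q₂ = V(q₂)` (so `X = V(q₁q₂)`), where `Q₁` is smooth and `n ≥ 4`.  Then
`[X] ≡ 1 mod 𝕃` in `K₀(Var_k)`. -/
theorem union_of_two_quadrics_class_eq_one (k : Type u) [Field k] [IsAlgClosed k]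
    [CharZero k] (n : ℕ) (hn : 4 ≤ n)
    (q₁ q₂ : MvPolynomial (Fin (n + 1)) k)
    (hq₁ : q₁.IsHomogeneous 2) (hq₂ : q₂.IsHomogeneous 2)
    (hq₁0 : q₁ ≠ 0) (hq₂0 : q₂ ≠ 0)
    (Q₁ : Scheme.{u}) (sQ₁ : Q₁ ⟶ SpecBase k) (hQ₁ : IsProjSubvariety k n {q₁} Q₁ sQ₁)
    (hQ₁smooth : IsSmooth sQ₁)
    (X : Scheme.{u}) (sX : X ⟶ SpecBase k) (hX : IsProjSubvariety k n {q₁ * q₂} X sX) :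
    ∀ (R : Type u) [CommRing R] (μ : MotivicMeasure k R),
      μ.cl X sX - 1 ∈ Ideal.span {μ.lef} := by
  intro R _ μ
  obtain ⟨-, i, _, rfl, hi⟩ := hX
  let ν := μ.map (Ideal.Quotient.mk (Ideal.span {μ.lef}))
  have hν : ν.lef = 0 := Ideal.Quotient.eq_zero_iff_mem.mpr (Ideal.mem_span_singleton_self _)
  have h := ν.lef_sub_one_mul_cl_eq (by norm_num) (hq₁.mul hq₂) (n + 1) 0 rfl i
    (by rwa [ProjSpace.sliceEquations_zero])
  rw [ProjSpace.sliceEquations_zero, ν.alg_quotient_mul_quadratic hν (by omega) hq₁ hq₂, hν,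
    zero_sub, neg_one_mul, neg_inj] at h
  exact Ideal.Quotient.eq.mp (h.trans (map_one _).symm)
end
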